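/- arXiv:2012.01226 — 6 statements merged into one kernel-verified Lean document; each statement's English description precedes it below -/
import Mathlib

section
/- Let N, M, c be positive integers with c > 6, let w: {1,…,N} → ℤ⁺ satisfy Σ_{i=1}^N w(i) = cM, set b = 12c+6 and k = 9bc+b, and let G be the caterpillar constructed from this data as described. If P_N with weights w has a uniform emulation f on P_M with emulation factor c such that f(1) = M, then the bandwidth of G is at most k. -/
/-- `f` is an emulation of the path `P_N` (vertices `1,…,N`) on the path `P_M`
(vertices `1,…,M`) that is uniform with emulation factor `c` for the weights `w`. -/
def IsUniformEmulation (N M c : ℕ) (w : ℕ → ℕ) (f : ℕ → ℕ) : Prop :=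
  (∀ i ∈ Finset.Icc 1 N, f i ∈ Finset.Icc 1 M) ∧
  (∀ i : ℕ, 1 ≤ i → i < N → |(f (i+1) : ℤ) - (f i : ℤ)| ≤ 1) ∧
  (∀ j ∈ Finset.Icc 1 M, ∑ i ∈ (Finset.Icc 1 N).filter (fun i => f i = j), w i = c)

namespace Caterpillar

/-- The constant `b = 12c+6`. -/
def b (c : ℕ) : ℕ := 12*c + 6

/-- The bandwidth bound `k = 9bc + b`. -/
def k (c : ℕ) : ℕ := 9*(b c)*c + b c

/-- Length of the filler path: chosen so that the number of vertices of `G` not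
belonging to the turning point equals `(5M-2)k - 1`.  (The vertices outside the
turning point are `p_0,…,p_{5M-3}`, the `2k-1` hairs of `p_0`, the `2(M-1)` groups of
`2k-2b` hairs on the spine, the `6N-5` vertices `y_i`, the `9b·Σw(i) = 9bcM` hairs of
the `y`-vertices, and the filler path itself.) -/
def fillLen (N M c : ℕ) : ℕ :=
  (5*M-2)*(k c) - 1 -
    ((5*M-2) + (2*(k c)-1) + 2*(M-1)*(2*(k c)-2*(b c)) + (6*N-5) + 9*(b c)*c*M)

/-- Vertex set of the caterpillar `G`: in order, the spine vertices `p_0,…,p_{5M-3}`,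
the `2k-1` hairs of `p_0`, the hairs of the vertices `p_{5i-2}` (`Bool` value `true`)
and `p_{5i}` (`Bool` value `false`) for `1 ≤ i ≤ M-1` (`2k-2b` hairs each), the turning
point vertices `v_b,…,v_g` (as `Fin 6`; `v_a` is identified with `p_{5M-3}`), the
`(3/2)(k-2)` hairs of `v_c`, the `(3/2)(k-2)` hairs of `v_f`, the `k` hairs of length
three of `v_d`, the path `y_1,…,y_{6N-5}`, the `9b·w(i)` hairs of `y_{6i-5}` for
`1 ≤ i ≤ N`, and the filler path. -/
def V (N M c : ℕ) (w : ℕ → ℕ) : Type :=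
  Fin (5*M-2) ⊕ Fin (2*(k c)-1) ⊕ (Fin (M-1) × Bool × Fin (2*(k c)-2*(b c))) ⊕
  Fin 6 ⊕ Fin (3*((k c)-2)/2) ⊕ Fin (3*((k c)-2)/2) ⊕ (Fin (k c) × Fin 3) ⊕
  Fin (6*N-5) ⊕ ((i : Fin N) × Fin (9*(b c)*(w (i.1+1)))) ⊕ Fin (fillLen N M c)

instance (N M c : ℕ) (w : ℕ → ℕ) : Fintype (V N M c w) := by
  unfold V; infer_instance

section
variable {N M c : ℕ} {w : ℕ → ℕ}

/-- The spine vertex `p_i` (for `0 ≤ i ≤ 5M-3`). -/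
def vp (i : Fin (5*M-2)) : V N M c w := Sum.inl i
/-- A hair of `p_0`. -/
def vp0hair (h : Fin (2*(k c)-1)) : V N M c w := Sum.inr (Sum.inl h)
/-- Hair `x.2.2` of the vertex `p_{5(x.1+1)-2}` (if `x.2.1 = true`) or `p_{5(x.1+1)}`
(if `x.2.1 = false`). -/
def vphair (x : Fin (M-1) × Bool × Fin (2*(k c)-2*(b c))) : V N M c w :=
  Sum.inr (Sum.inr (Sum.inl x))
/-- Turning point vertex: `0 ↦ v_b`, `1 ↦ v_c`, `2 ↦ v_d`, `3 ↦ v_e`, `4 ↦ v_f`,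
`5 ↦ v_g`. -/
def vtp (i : Fin 6) : V N M c w := Sum.inr (Sum.inr (Sum.inr (Sum.inl i)))
/-- A hair of `v_c`. -/
def vchair (h : Fin (3*((k c)-2)/2)) : V N M c w :=
  Sum.inr (Sum.inr (Sum.inr (Sum.inr (Sum.inl h))))
/-- A hair of `v_f`. -/
def vfhair (h : Fin (3*((k c)-2)/2)) : V N M c w :=
  Sum.inr (Sum.inr (Sum.inr (Sum.inr (Sum.inr (Sum.inl h)))))
/-- Vertex `x.2` of the hair (of length three) number `x.1` of `v_d`. -/
def vdhair (x : Fin (k c) × Fin 3) : V N M c w :=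
  Sum.inr (Sum.inr (Sum.inr (Sum.inr (Sum.inr (Sum.inr (Sum.inl x))))))
/-- The vertex `y_{i+1}` (for `i : Fin (6N-5)`, so `y_1` is `vy 0`). -/
def vy (i : Fin (6*N-5)) : V N M c w :=
  Sum.inr (Sum.inr (Sum.inr (Sum.inr (Sum.inr (Sum.inr (Sum.inr (Sum.inl i)))))))
/-- Hair `x.2` of the vertex `y_{6(x.1+1)-5}`. -/
def vyhair (x : (i : Fin N) × Fin (9*(b c)*(w (i.1+1)))) : V N M c w :=
  Sum.inr (Sum.inr (Sum.inr (Sum.inr (Sum.inr (Sum.inr (Sum.inr (Sum.inr (Sum.inl x))))))))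
/-- The `j`-th vertex of the filler path. -/
def vfill (j : Fin (fillLen N M c)) : V N M c w :=
  Sum.inr (Sum.inr (Sum.inr (Sum.inr (Sum.inr (Sum.inr (Sum.inr (Sum.inr (Sum.inr j))))))))

end

/-- The edges of the caterpillar `G`: the spine path `p_0 p_1 ⋯ p_{5M-3}`, the `2k-1`
hairs of `p_0`, the `2k-2b` hairs of each of `p_{5i-2}` and `p_{5i}` (`1 ≤ i ≤ M-1`),
the turning point path `v_a v_b ⋯ v_g` with `v_a = p_{5M-3}`, hairs at `v_c` and `v_f`,
the `k` hairs of length three at `v_d`, the edge `v_g y_1`, the path `y_1 ⋯ y_{6N-5}`,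
the `9b·w(i)` hairs of `y_{6i-5}`, and the filler path attached to `y_{6N-5}`. -/
inductive Adj (N M c : ℕ) (w : ℕ → ℕ) : V N M c w → V N M c w → Prop where
  | spine (i j : Fin (5*M-2)) : j.1 = i.1 + 1 → Adj N M c w (vp i) (vp j)
  | hair0 (h : Fin (2*(k c)-1)) (i : Fin (5*M-2)) : i.1 = 0 →
      Adj N M c w (vp0hair h) (vp i)
  | phairE (i' : Fin (M-1)) (s : Bool) (h : Fin (2*(k c)-2*(b c))) (i : Fin (5*M-2)) :
      i.1 = 5*(i'.1+1) - (cond s 2 0) → Adj N M c w (vphair (i', s, h)) (vp i)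
  | tpEnter (i : Fin (5*M-2)) : i.1 = 5*M-3 → Adj N M c w (vp i) (vtp 0)
  | tpSpine (a b : Fin 6) : b.1 = a.1 + 1 → Adj N M c w (vtp a) (vtp b)
  | chairE (h : Fin (3*((k c)-2)/2)) : Adj N M c w (vchair h) (vtp 1)
  | fhairE (h : Fin (3*((k c)-2)/2)) : Adj N M c w (vfhair h) (vtp 4)
  | dhair0 (h : Fin (k c)) : Adj N M c w (vdhair (h, 0)) (vtp 2)
  | dpath (h : Fin (k c)) (l l' : Fin 3) : l'.1 = l.1 + 1 →
      Adj N M c w (vdhair (h, l)) (vdhair (h, l'))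
  | yEnter (i : Fin (6*N-5)) : i.1 = 0 → Adj N M c w (vtp 5) (vy i)
  | ySpine (i j : Fin (6*N-5)) : j.1 = i.1 + 1 → Adj N M c w (vy i) (vy j)
  | yhairE (x : (i : Fin N) × Fin (9*(b c)*(w (i.1+1)))) (m : Fin (6*N-5)) :
      m.1 = 6*x.1.1 → Adj N M c w (vyhair x) (vy m)
  | fillEnter (m : Fin (6*N-5)) (j : Fin (fillLen N M c)) : m.1 = 6*N-6 → j.1 = 0 →
      Adj N M c w (vy m) (vfill j)
  | fillPath (j j' : Fin (fillLen N M c)) : j'.1 = j.1 + 1 →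
      Adj N M c w (vfill j) (vfill j')

/-- The caterpillar graph `G` constructed from `N`, `M`, `c` and `w`. -/
def catG (N M c : ℕ) (w : ℕ → ℕ) : SimpleGraph (V N M c w) :=
  SimpleGraph.fromRel (Adj N M c w)

/-- `G` has bandwidth at most `k`: some linear ordering (bijection of the vertices with
`{1,…,n}`, here `Fin n` with `n` the number of vertices) puts the endpoints of every
edge at distance at most `k`. -/
def BandwidthLE {α : Type*} [Fintype α] (G : SimpleGraph α) (k : ℕ) : Prop :=
  ∃ g : α ≃ Fin (Fintype.card α),
    ∀ u v : α, G.Adj u v → |((g u : ℕ) : ℤ) - ((g v : ℕ) : ℤ)| ≤ (k:ℤ)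

end Caterpillar

namespace Caterpillar

/-- An injective map to `ℕ` that stretches no edge beyond `K` can be compressed to a linear
ordering of bandwidth at most `K`. -/
theorem bandwidthLE_of_injective {α : Type*} [Fintype α] (G : SimpleGraph α) (K : ℕ)
    (pos : α → ℕ) (hinj : Function.Injective pos)
    (hadj : ∀ u v, G.Adj u v → pos u ≤ pos v + K) : BandwidthLE G K := by
  classical
  set S : Finset ℕ := Finset.univ.image pos with hS
  have hcard : S.card = Fintype.card α := by
    rw [hS, Finset.card_image_of_injective _ hinj, Finset.card_univ]
  have hmem (u : α) : pos u ∈ S := Finset.mem_image_of_mem _ (Finset.mem_univ u)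
  let e : Fin (Fintype.card α) ≃o S := S.orderIsoOfFin hcard
  let g : α → Fin (Fintype.card α) := fun u => e.symm ⟨pos u, hmem u⟩
  have heg (u : α) : ((e (g u) : S) : ℕ) = pos u := by simp [g]
  have hg : Function.Injective g := fun u v h => hinj (by rw [← heg u, ← heg v, h])
  have hgap : ∀ (d : ℕ) (i j : Fin (Fintype.card α)), (j : ℕ) = i + d →
      ((e i : S) : ℕ) + d ≤ (e j : S) := by
    intro d
    induction d with
    | zero => intro i j h; rw [Fin.ext (by simpa using h) (a := j) (b := i)]; simp
    | succ d ih =>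
      intro i j h
      have hlt : (i : ℕ) + d < Fintype.card α := by have := j.isLt; omega
      have h1 := ih i ⟨i + d, hlt⟩ rfl
      have h2 : e ⟨i + d, hlt⟩ < e j := e.strictMono (by rw [Fin.lt_def]; simp only; omega)
      have h3 : ((e ⟨i + d, hlt⟩ : S) : ℕ) < (e j : S) := h2
      omega
  have hle : ∀ u v, G.Adj u v → (g u : ℕ) ≤ g v + K := by
    intro u v huv
    by_contra! hlt
    have h1 := hgap ((g u : ℕ) - g v) (g v) (g u) (by omega)
    rw [heg, heg] at h1
    have := hadj u v huv
    omega
  refine ⟨Equiv.ofBijective g ((Fintype.bijective_iff_injective_and_card g).2 ⟨hg, by simp⟩), ?_⟩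
  intro u v huv
  have h1 := hle u v huv
  have h2 := hle v u huv.symm
  simp only [Equiv.ofBijective_apply]
  rw [abs_le]
  omega

/-- The position at offset `x.2` in the bucket number `x.1`, for buckets of size `K`; the spine
vertex `p_m` opens bucket number `m`. -/
def cellPos (K : ℕ) (x : ℕ × ℕ) : ℕ := (x.1 + 1) * K + x.2

/-- A sufficient condition for two cells to be at distance at most the size of the buckets. -/
def Near (x y : ℕ × ℕ) : Prop :=
  x.1 = y.1 ∨ (y.1 = x.1 + 1 ∧ y.2 ≤ x.2) ∨ (x.1 = y.1 + 1 ∧ x.2 ≤ y.2)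

theorem cellPos_inj {K : ℕ} {x y : ℕ × ℕ} (hx : x.2 < K) (hy : y.2 < K)
    (h : cellPos K x = cellPos K y) : x = y := by
  have hK : 0 < K := by omega
  have e (z : ℕ × ℕ) (hz : z.2 < K) : cellPos K z / K = z.1 + 1 ∧ cellPos K z % K = z.2 := by
    unfold cellPos
    rw [Nat.add_comm, Nat.add_mul_div_right _ _ hK, Nat.add_mul_mod_self_right,
      Nat.div_eq_of_lt hz, Nat.mod_eq_of_lt hz]
    simp
  have h1 := e x hx
  have h2 := e y hy
  rw [h] at h1
  ext <;> omega

theorem Near.cellPos_le {K : ℕ} {x y : ℕ × ℕ} (h : Near x y) (hx : x.2 < K) (hy : y.2 < K) :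
    cellPos K x ≤ cellPos K y + K ∧ cellPos K y ≤ cellPos K x + K := by
  unfold cellPos
  rcases h with h | ⟨h, h'⟩ | ⟨h, h'⟩ <;> rw [h] <;> constructor <;> nlinarith

/-- The cell of vertex number `6q+t` of the path `y`, where `a q` is the chamber of the
weighted vertex number `q` and `s q < c` identifies that vertex inside its chamber.
Chamber `j` is bucket `5j+1`. -/
def yCell (a s : ℕ → ℕ) (c q t : ℕ) : ℕ × ℕ :=
  if t = 0 then (5 * a q + 1, 3 + s q)
  else if a (q + 1) = a q then (5 * a q + 1, 2 + c + 5 * s q + t)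
  else if a q < a (q + 1) then
    if t = 1 then (5 * a q + 1, 3 + 6 * c + s q) else (5 * a q + t, 3 + c + s q)
  else if t = 5 then (5 * a (q + 1) + 1, 3 + 7 * c + s (q + 1))
  else (5 * a q + 1 - t, 3 + 2 * c + s q)

/-- What the layout of the path `y` needs to know about its weights `W`, chambers `a` and
identifiers `s`. -/
structure Route (N M c : ℕ) (W a s : ℕ → ℕ) : Prop where
  lt : ∀ q, q < N → a q < M
  step : ∀ q, q + 1 < N → a (q + 1) ≤ a q + 1 ∧ a q ≤ a (q + 1) + 1
  weight_pos : ∀ q, q < N → 0 < W q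
  add_le : ∀ q, q < N → s q + W q ≤ c
  add_le_of_lt : ∀ q q', q < q' → q' < N → a q = a q' → s q + W q ≤ s q'

section
variable {N M c : ℕ} {W a s : ℕ → ℕ}

theorem Route.id_lt (h : Route N M c W a s) (q : ℕ) (hq : q < N) : s q < c := by
  have h1 := h.weight_pos q hq
  have h2 := h.add_le q hq
  omega

theorem Route.inj (h : Route N M c W a s) (q q' : ℕ) (hq : q < N) (hq' : q' < N)
    (ha : a q = a q') (hs : s q = s q') : q = q' := by
  have h1 := h.weight_pos q hq
  have h2 := h.weight_pos q' hq'
  rcases lt_trichotomy q q' with h3 | h3 | h3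
  · have := h.add_le_of_lt q q' h3 hq' ha; omega
  · exact h3
  · have := h.add_le_of_lt q' q h3 hq ha.symm; omega

theorem Route.yCell_bounds (h : Route N M c W a s) {q t : ℕ} (ht : t < 6)
    (hq : 6 * q + t < 6 * N - 5) :
    1 ≤ (yCell a s c q t).1 ∧ (yCell a s c q t).1 + 4 ≤ 5 * M ∧
    3 ≤ (yCell a s c q t).2 ∧ (yCell a s c q t).2 < 3 + 8 * c := by
  have h1 := h.lt q (by omega)
  have h3 := h.id_lt q (by omega)
  by_cases h0 : t = 0
  · simp only [yCell, h0, if_true]; omega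
  have h2 := h.lt (q + 1) (by omega)
  have h4 := h.id_lt (q + 1) (by omega)
  have h5 := h.step q (by omega)
  unfold yCell
  split_ifs <;> simp only <;> omega

theorem Route.yCell_inj (h : Route N M c W a s) {q t q' t' : ℕ} (ht : t < 6) (ht' : t' < 6)
    (hq : 6 * q + t < 6 * N - 5) (hq' : 6 * q' + t' < 6 * N - 5)
    (he : yCell a s c q t = yCell a s c q' t') : q = q' ∧ t = t' := by
  have i1 := h.inj q q' (by omega) (by omega)
  have h1 := h.id_lt q (by omega)
  have h1' := h.id_lt q' (by omega)
  have i2 : t ≠ 0 → t' ≠ 0 → a (q + 1) = a (q' + 1) → s (q + 1) = s (q' + 1) → q = q' := by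
    intro _ _ h1 h2
    have := h.inj (q + 1) (q' + 1) (by omega) (by omega) h1 h2
    omega
  have h2 : t ≠ 0 → s (q + 1) < c := fun _ => h.id_lt _ (by omega)
  have h2' : t' ≠ 0 → s (q' + 1) < c := fun _ => h.id_lt _ (by omega)
  have h3 : t ≠ 0 → a q ≤ a (q + 1) + 1 := fun _ => (h.step _ (by omega)).2
  have h3' : t' ≠ 0 → a q' ≤ a (q' + 1) + 1 := fun _ => (h.step _ (by omega)).2
  unfold yCell at he
  split_ifs at he <;> simp only [Prod.mk.injEq] at he <;> omega

theorem Route.yCell_near (h : Route N M c W a s) {q t : ℕ} (ht : t + 1 < 6)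
    (hq : 6 * q + t + 1 < 6 * N - 5) : Near (yCell a s c q t) (yCell a s c q (t + 1)) := by
  have h1 := h.id_lt q (by omega)
  have h2 := h.id_lt (q + 1) (by omega)
  have h3 := h.step q (by omega)
  unfold yCell Near
  split_ifs <;> first | contradiction | exact Or.inl rfl | (simp only; omega)

theorem Route.yCell_near_succ (h : Route N M c W a s) {q : ℕ} (hq : q + 1 < N) :
    Near (yCell a s c q 5) (yCell a s c (q + 1) 0) := by
  have h1 := h.id_lt q (by omega)
  have h2 := h.id_lt (q + 1) (by omega)
  have h3 := h.step q (by omega)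
  unfold yCell Near
  split_ifs <;> first | contradiction | exact Or.inl rfl | (simp only; omega)

end

theorem k_eq (c : ℕ) : k c = 9 * (b c * c) + b c := by unfold k; ring

theorem seven_mul_b_le {c : ℕ} (hc : 6 < c) : 7 * b c ≤ b c * c := by nlinarith

theorem even_k (c : ℕ) : ∃ r, k c = 2 * r :=
  ⟨9 * (6 * c + 3) * c + (6 * c + 3), by unfold k b; ring⟩

/-- The position of the vertex `v_a = p_{5M-3}`. -/
def apex (M c : ℕ) : ℕ := (5 * M - 2) * k c - 2

theorem apex_spec {M c : ℕ} (hM : 1 ≤ M) (hc : 6 < c) :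
    apex M c + 2 = (5 * M - 3) * k c + k c ∧ 2 * k c ≤ (5 * M - 3) * k c := by
  have h1 := k_eq c
  have h2 := seven_mul_b_le hc
  have h3 : (5 * M - 2) * k c = (5 * M - 3) * k c + k c := by
    rw [show 5 * M - 2 = 5 * M - 3 + 1 by omega]; ring
  have h4 : 2 * k c ≤ (5 * M - 3) * k c := Nat.mul_le_mul_right _ (by omega)
  have h5 : b c = 12 * c + 6 := rfl
  refine ⟨?_, h4⟩
  unfold apex
  omega

section
variable {N M c : ℕ} {w : ℕ → ℕ}

/-- The vertices laid out in the buckets by explicit cells: the hairs of the spine, the path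
`y`, and the hairs of the path `y`. -/
abbrev Mid (N M c : ℕ) (w : ℕ → ℕ) : Type :=
  (Fin (M-1) × Bool × Fin (2*(k c)-2*(b c))) ⊕ Fin (6*N-5) ⊕
    ((i : Fin N) × Fin (9*(b c)*(w (i.1+1))))

/-- The cell of hair `x.2.2` of the spine vertex given by `x.1` and `x.2.1`. -/
def phairCell (c : ℕ) (x : Fin (M-1) × Bool × Fin (2*(k c)-2*(b c))) : ℕ × ℕ :=
  (5 * x.1 + 2 + cond x.2.1 0 2 + if (x.2.2 : ℕ) < k c - b c then 0 else 1,
    b c + if (x.2.2 : ℕ) < k c - b c then (x.2.2 : ℕ) else x.2.2 - (k c - b c))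

/-- The cell of hair `x.2` of the weighted vertex number `x.1` of the path `y`. -/
def yhairCell (a s : ℕ → ℕ) (x : (i : Fin N) × Fin (9*(b c)*(w (i.1+1)))) : ℕ × ℕ :=
  (5 * a x.1 + 1, b c - 2 + 9 * (b c * s x.1) + x.2)

/-- The cell of a vertex of type `Mid`. -/
def midCell (a s : ℕ → ℕ) : Mid N M c w → ℕ × ℕ :=
  Sum.elim (phairCell c)
    (Sum.elim (fun n => yCell a s c (n / 6) (n % 6)) (yhairCell a s))

variable {a s : ℕ → ℕ}

theorem phairCell_bounds (x : Fin (M-1) × Bool × Fin (2*(k c)-2*(b c))) :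
    1 ≤ (phairCell c x).1 ∧ (phairCell c x).1 + 5 ≤ 5 * M ∧ (phairCell c x).1 % 5 ≠ 1 ∧
    b c ≤ (phairCell c x).2 ∧ (phairCell c x).2 < k c := by
  obtain ⟨⟨i, hi⟩, t, ⟨h, hh⟩⟩ := x
  unfold phairCell
  have := k_eq c
  cases t <;> simp only [cond] <;> split_ifs <;> omega

theorem phairCell_inj : Function.Injective (phairCell (M := M) c) := by
  rintro ⟨⟨i, hi⟩, t, ⟨h, hh⟩⟩ ⟨⟨i', hi'⟩, t', ⟨h', hh'⟩⟩ he
  simp only [phairCell, Prod.mk.injEq] at he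
  simp only [Prod.mk.injEq, Fin.mk.injEq]
  cases t <;> cases t' <;> simp only [cond] at he <;> split_ifs at he <;> simp <;> omega

theorem Route.yhairCell_bounds (h : Route N M c (fun q => w (q + 1)) a s)
    (x : (i : Fin N) × Fin (9*(b c)*(w (i.1+1)))) :
    (yhairCell a s x).1 + 4 ≤ 5 * M ∧ (yhairCell a s x).1 % 5 = 1 ∧
    b c - 2 ≤ (yhairCell a s x).2 ∧ (yhairCell a s x).2 + 2 < k c := by
  obtain ⟨⟨i, hi⟩, ⟨m, hm⟩⟩ := x
  have h1 := h.lt i hi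
  have h2 := Nat.mul_le_mul_left (b c) (h.add_le i hi)
  have h3 := k_eq c
  have h4 : b c = 12 * c + 6 := rfl
  simp only [yhairCell]
  rw [Nat.mul_add] at h2
  rw [Nat.mul_assoc] at hm
  simp only at hm
  omega

theorem Route.yhairCell_inj (h : Route N M c (fun q => w (q + 1)) a s) :
    Function.Injective (yhairCell (N := N) (c := c) (w := w) a s) := by
  have key : ∀ i i' m m' : ℕ, i < i' → i' < N → m < 9 * b c * w (i + 1) → a i = a i' →
      9 * (b c * s i) + m ≠ 9 * (b c * s i') + m' := by
    intro i i' m m' hlt hi' hm ha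
    have h2 := Nat.mul_le_mul_left (b c) (h.add_le_of_lt i i' hlt hi' ha)
    rw [Nat.mul_add] at h2
    rw [Nat.mul_assoc] at hm
    omega
  rintro ⟨⟨i, hi⟩, ⟨m, hm⟩⟩ ⟨⟨i', hi'⟩, ⟨m', hm'⟩⟩ he
  simp only [yhairCell, Prod.mk.injEq] at he
  rcases lt_trichotomy i i' with h3 | h3 | h3
  · exact absurd (by omega) (key i i' m m' h3 hi' hm (by omega))
  · subst h3
    have : m = m' := by omega
    subst this
    rfl
  · exact absurd (by omega) (key i' i m' m h3 hi hm' (by omega))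

theorem Route.yCell_bounds' (h : Route N M c (fun q => w (q + 1)) a s) (n : Fin (6 * N - 5)) :
    1 ≤ (yCell a s c (n / 6) (n % 6)).1 ∧ (yCell a s c (n / 6) (n % 6)).1 + 4 ≤ 5 * M ∧
    3 ≤ (yCell a s c (n / 6) (n % 6)).2 ∧ (yCell a s c (n / 6) (n % 6)).2 + 2 < b c := by
  have h1 := h.yCell_bounds (q := n / 6) (t := n % 6) (by omega) (by omega)
  have h4 : b c = 12 * c + 6 := rfl
  omega

theorem Route.midCell_bounds (h : Route N M c (fun q => w (q + 1)) a s)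
    (x : Mid N M c w) :
    1 ≤ (midCell a s x).1 ∧ (midCell a s x).1 + 4 ≤ 5 * M ∧ 3 ≤ (midCell a s x).2 ∧
    (midCell a s x).2 < k c ∧ ((midCell a s x).1 + 5 ≤ 5 * M ∨ (midCell a s x).2 + 2 < k c) := by
  have h4 : b c = 12 * c + 6 := rfl
  have h3 := k_eq c
  rcases x with x | n | x
  · have := phairCell_bounds x
    simp only [midCell, Sum.elim_inl]
    omega
  · have := h.yCell_bounds' n
    simp only [midCell, Sum.elim_inl, Sum.elim_inr]
    omega
  · have := h.yhairCell_bounds x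
    simp only [midCell, Sum.elim_inr]
    omega

theorem Route.midCell_inj (h : Route N M c (fun q => w (q + 1)) a s) :
    Function.Injective (midCell (N := N) (M := M) (c := c) (w := w) a s) := by
  refine Function.Injective.sumElim phairCell_inj
    (Function.Injective.sumElim ?_ h.yhairCell_inj ?_) ?_
  · intro n n' he
    have := h.yCell_inj (q := n / 6) (t := n % 6) (by omega) (by omega) (by omega) (by omega) he
    omega
  · intro n x he
    have h1 := h.yCell_bounds' n
    have h2 := h.yhairCell_bounds x
    rw [he] at h1
    omega
  · intro x y he
    have h1 := phairCell_bounds x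
    rw [he] at h1
    rcases y with n | x
    · have h2 := h.yCell_bounds' n
      simp only [Sum.elim_inl] at h1
      omega
    · have h2 := h.yhairCell_bounds x
      simp only [Sum.elim_inr] at h1
      omega

/-- The vertices outside of the turning point and of the filler path. -/
abbrev Base (N M c : ℕ) (w : ℕ → ℕ) : Type :=
  Fin (5*M-2) ⊕ Fin (2*(k c)-1) ⊕ Mid N M c w

/-- The positions of the vertices outside of the turning point and of the filler path. -/
def basePos (a s : ℕ → ℕ) : Base N M c w → ℕ :=
  Sum.elim (fun i => min ((i + 1) * k c) (apex M c))
    (Sum.elim (fun h => if (h : ℕ) < k c then (h : ℕ) else h + 1)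
      (fun x => cellPos (k c) (midCell a s x)))

theorem spine_pos (hM : 1 ≤ M) (hc : 6 < c) (i : Fin (5 * M - 2)) :
    (i : ℕ) + 3 < 5 * M ∧ min ((i + 1) * k c) (apex M c) = cellPos (k c) (i, 0) ∧
        cellPos (k c) (i, 0) < apex M c ∨
      (i : ℕ) + 3 = 5 * M ∧ min ((i + 1) * k c) (apex M c) = apex M c := by
  obtain ⟨h1, h2⟩ := apex_spec hM hc
  have h3 := k_eq c
  have h4 : b c = 12 * c + 6 := rfl
  by_cases hi : (i : ℕ) + 3 < 5 * M
  · left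
    have h5 : ((i : ℕ) + 1) * k c ≤ (5 * M - 3) * k c := Nat.mul_le_mul_right _ (by omega)
    unfold cellPos
    simp only
    omega
  · right
    have h5 : (i : ℕ) + 1 = 5 * M - 3 + 1 := by omega
    have h6 : ((i : ℕ) + 1) * k c = (5 * M - 3) * k c + k c := by rw [h5]; ring
    omega

theorem cellPos_bounds (hM : 1 ≤ M) (hc : 6 < c) {x : ℕ × ℕ} (h1 : 1 ≤ x.1)
    (h2 : x.1 + 4 ≤ 5 * M) (h3 : x.2 < k c) (h4 : x.1 + 5 ≤ 5 * M ∨ x.2 + 2 < k c) :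
    2 * k c + x.2 ≤ cellPos (k c) x ∧ cellPos (k c) x < apex M c := by
  obtain ⟨h5, h6⟩ := apex_spec hM hc
  have h7 := k_eq c
  have h9 := seven_mul_b_le hc
  have h10 : b c = 12 * c + 6 := rfl
  have h8 : 2 * k c ≤ (x.1 + 1) * k c := Nat.mul_le_mul_right _ (by omega)
  unfold cellPos
  refine ⟨by omega, ?_⟩
  rcases h4 with h4 | h4
  · have : (x.1 + 1 + 1) * k c ≤ (5 * M - 3) * k c := Nat.mul_le_mul_right _ (by omega)
    rw [Nat.add_mul] at this
    omega
  · have : (x.1 + 1) * k c ≤ (5 * M - 3) * k c := Nat.mul_le_mul_right _ (by omega)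
    omega

theorem Route.midPos_bounds (h : Route N M c (fun q => w (q + 1)) a s) (hM : 1 ≤ M) (hc : 6 < c)
    (x : Mid N M c w) :
    2 * k c + 3 ≤ cellPos (k c) (midCell a s x) ∧ cellPos (k c) (midCell a s x) < apex M c := by
  obtain ⟨h1, h2, h3, h4, h5⟩ := h.midCell_bounds x
  have := cellPos_bounds hM hc h1 h2 h4 h5
  omega

theorem Route.basePos_le (h : Route N M c (fun q => w (q + 1)) a s) (hM : 1 ≤ M) (hc : 6 < c)
    (x : Base N M c w) : basePos a s x ≤ apex M c := by
  rcases x with i | m | x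
  · exact min_le_right _ _
  · obtain ⟨h1, h2⟩ := apex_spec hM hc
    have := k_eq c
    have h4 : b c = 12 * c + 6 := rfl
    simp only [basePos, Sum.elim_inl, Sum.elim_inr]
    split_ifs <;> omega
  · exact (h.midPos_bounds hM hc x).2.le

theorem Route.basePos_inj (h : Route N M c (fun q => w (q + 1)) a s) (hM : 1 ≤ M) (hc : 6 < c) :
    Function.Injective (basePos (N := N) (M := M) (c := c) (w := w) a s) := by
  have hk : 0 < k c := by unfold k b; omega
  obtain ⟨h1, h2⟩ := apex_spec hM hc
  refine Function.Injective.sumElim ?_ (Function.Injective.sumElim ?_ ?_ ?_) ?_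
  · intro i j he
    simp only at he
    rcases spine_pos hM hc i with ⟨h3, h4, h5⟩ | ⟨h3, h4⟩ <;>
    rcases spine_pos hM hc j with ⟨h3', h4', h5'⟩ | ⟨h3', h4'⟩ <;>
    rw [h4, h4'] at he
    · have := congrArg Prod.fst (cellPos_inj (by exact hk) (by exact hk) he)
      exact Fin.ext this
    all_goals omega
  · intro i j he
    simp only at he
    split_ifs at he <;> omega
  · intro x y he
    exact h.midCell_inj (cellPos_inj (h.midCell_bounds x).2.2.2.1
      (h.midCell_bounds y).2.2.2.1 he)
  · intro i x he
    have := (h.midPos_bounds hM hc x).1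
    split_ifs at he <;> omega
  · rintro i (m | x) he <;> simp only [Sum.elim_inl, Sum.elim_inr] at he
    · have h6 : (i : ℕ) = 0 ∨ 2 * k c ≤ (i + 1) * k c := by
        by_cases hi : (i : ℕ) = 0
        · exact Or.inl hi
        · exact Or.inr (Nat.mul_le_mul_right _ (by omega))
      rcases h6 with h6 | h6
      · rw [h6] at he
        split_ifs at he <;> omega
      · split_ifs at he <;> omega
    · rcases spine_pos hM hc i with ⟨h3, h4, h5⟩ | ⟨h3, h4⟩
      · rw [h4] at he
        have := congrArg Prod.snd (cellPos_inj (by exact hk) (h.midCell_bounds x).2.2.2.1 he)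
        have := (h.midCell_bounds x).2.2.1
        simp only at *
        omega
      · have := (h.midPos_bounds hM hc x).2
        omega

theorem Route.cellPos_notMem_range (h : Route N M c (fun q => w (q + 1)) a s) (hM : 1 ≤ M)
    (hc : 6 < c) {m o : ℕ} (hm : 1 ≤ m) (hm' : m + 4 ≤ 5 * M) (ho : o = 1 ∨ o = 2)
    (x : Base N M c w) : basePos a s x ≠ cellPos (k c) (m, o) := by
  have hk := k_eq c
  have hb : b c = 12 * c + 6 := rfl
  have hx : cellPos (k c) (m, o) < apex M c ∧ 2 * k c + o ≤ cellPos (k c) (m, o) :=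
    (cellPos_bounds hM hc (x := (m, o)) hm hm' (by simp only; omega) (by simp only; omega)).symm
  intro he
  rcases x with i | n | x <;> simp only [basePos, Sum.elim_inl, Sum.elim_inr] at he
  · rcases spine_pos hM hc i with ⟨h3, h4, h5⟩ | ⟨h3, h4⟩
    · rw [h4] at he
      have := congrArg Prod.snd
        (cellPos_inj (by simp only; omega) (by simp only; omega) he)
      simp only at this
      omega
    · omega
  · split_ifs at he <;> omega
  · have h1 := (h.midCell_bounds x)
    have := congrArg Prod.snd (cellPos_inj h1.2.2.2.1 (by simp only; omega) he)
    simp only at this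
    omega

theorem exists_basePos_eq (hM : 1 ≤ M) (hc : 6 < c) {n : ℕ} (hn : n < 2 * k c) :
    ∃ x : Base N M c w, basePos a s x = n := by
  obtain ⟨h1, h2⟩ := apex_spec hM hc
  rcases lt_trichotomy n (k c) with h | h | h
  · exact ⟨Sum.inr (Sum.inl ⟨n, by omega⟩), by simp [basePos, h]⟩
  · refine ⟨Sum.inl ⟨0, by omega⟩, ?_⟩
    simp only [basePos, Sum.elim_inl]
    omega
  · refine ⟨Sum.inr (Sum.inl ⟨n - 1, by omega⟩), ?_⟩
    simp only [basePos, Sum.elim_inl, Sum.elim_inr]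
    split_ifs <;> omega

/-- The cells of offset `2` in the first `m` buckets, which the filler path uses to run to the
left. -/
def returnCells (c m : ℕ) : Finset ℕ := (Finset.Icc 1 m).image (fun i => cellPos (k c) (i, 2))

/-- The positions left of the turning point which the filler path fills from left to right. -/
def freePos (N M c : ℕ) (w a s : ℕ → ℕ) (m : ℕ) : Finset ℕ :=
  Finset.range (apex M c + 1) \
    (Finset.univ.image (basePos (N := N) (M := M) (c := c) (w := w) a s) ∪ returnCells c m)

/-- The position of the vertex number `j` of a filler path starting in bucket `m`. -/
noncomputable def fillPos (N M c : ℕ) (w a s : ℕ → ℕ) (m j : ℕ) : ℕ :=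
  if j < m then cellPos (k c) (m - j, 2) else Nat.nth (· ∈ freePos N M c w a s m) (j - m)

theorem card_base (hw : ∑ i ∈ Finset.range N, w (i + 1) = c * M) :
    Fintype.card (Base N M c w) = (5*M-2) + (2*(k c)-1) + 2*(M-1)*(2*(k c)-2*(b c)) +
      (6*N-5) + 9*(b c)*c*M := by
  simp only [Fintype.card_sum, Fintype.card_prod, Fintype.card_fin, Fintype.card_bool,
    Fintype.card_sigma]
  rw [← Finset.mul_sum, Fin.sum_univ_eq_sum_range (fun i => w (i + 1)), hw]
  ring

theorem fillLen_le_card_freePos (hM : 1 ≤ M) (hc : 6 < c)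
    (hw : ∑ i ∈ Finset.range N, w (i + 1) = c * M) (m : ℕ) :
    fillLen N M c ≤ m + (freePos N M c w a s m).card := by
  have h1 : (Finset.univ.image (basePos (N := N) (M := M) (c := c) (w := w) a s)).card ≤ _ :=
    Finset.card_image_le
  rw [Finset.card_univ, card_base hw] at h1
  have h2 : (returnCells c m).card ≤ _ := Finset.card_image_le
  rw [Nat.card_Icc] at h2
  have h3 := Finset.card_union_le
    (Finset.univ.image (basePos (N := N) (M := M) (c := c) (w := w) a s)) (returnCells c m)
  have h4 := Finset.le_card_sdiff
    (Finset.univ.image (basePos (N := N) (M := M) (c := c) (w := w) a s) ∪ returnCells c m)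
    (Finset.range (apex M c + 1))
  rw [Finset.card_range] at h4
  unfold freePos fillLen
  obtain ⟨h5, h6⟩ := apex_spec hM hc
  have h7 : apex M c = (5 * M - 2) * k c - 2 := rfl
  have h8 := k_eq c
  have h9 : b c = 12 * c + 6 := rfl
  omega

theorem nth_mem_finset (S : Finset ℕ) {n : ℕ} (hn : n < S.card) : Nat.nth (· ∈ S) n ∈ S := by
  have hf : (Set.ofPred (· ∈ S)).Finite := S.finite_toSet
  have : hf.toFinset = S := by ext; simp
  exact Nat.nth_mem_of_lt_card (p := (· ∈ S)) hf (by rwa [this])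

theorem nth_finset_lt (S : Finset ℕ) {m n : ℕ} (hmn : m < n) (hn : n < S.card) :
    Nat.nth (· ∈ S) m < Nat.nth (· ∈ S) n := by
  have hf : (Set.ofPred (· ∈ S)).Finite := S.finite_toSet
  have : hf.toFinset = S := by ext; simp
  exact Nat.nth_lt_nth_of_lt_card (p := (· ∈ S)) hf hmn (by rwa [this])

theorem Route.one_mem_freePos (h : Route N M c (fun q => w (q + 1)) a s) (hM : 1 ≤ M)
    (hc : 6 < c) {m i : ℕ} (hi : 1 ≤ i) (hi' : i + 4 ≤ 5 * M) :
    cellPos (k c) (i, 1) ∈ freePos N M c w a s m := by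
  have hk := k_eq c
  have hb : b c = 12 * c + 6 := rfl
  have hx := (cellPos_bounds hM hc (x := (i, 1)) hi hi' (by simp only; omega)
    (by simp only; omega)).2
  simp only [freePos, returnCells, Finset.mem_sdiff, Finset.mem_range, Finset.mem_union,
    Finset.mem_image, Finset.mem_univ, true_and, not_or, not_exists]
  refine ⟨by omega, h.cellPos_notMem_range hM hc hi hi' (Or.inl rfl), ?_⟩
  rintro j ⟨-, hj⟩
  have := congrArg Prod.snd (cellPos_inj (by simp only; omega) (by simp only; omega) hj)
  simp at this

theorem mem_freePos_iff {m n : ℕ} : n ∈ freePos N M c w a s m ↔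
    n ≤ apex M c ∧ (∀ x : Base N M c w, basePos a s x ≠ n) ∧
      ∀ i, 1 ≤ i → i ≤ m → cellPos (k c) (i, 2) ≠ n := by
  simp [freePos, returnCells]
  tauto

theorem Route.fillPos_spec (h : Route N M c (fun q => w (q + 1)) a s) (hM : 1 ≤ M)
    (hc : 6 < c) (hw : ∑ i ∈ Finset.range N, w (i + 1) = c * M) {m j : ℕ} (hm : m + 4 ≤ 5 * M)
    (hj : j < fillLen N M c) :
    fillPos N M c w a s m j ≤ apex M c ∧
      ∀ x : Base N M c w, basePos a s x ≠ fillPos N M c w a s m j := by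
  have hk := k_eq c
  have hb : b c = 12 * c + 6 := rfl
  unfold fillPos
  split_ifs with hjm
  · exact ⟨(cellPos_bounds hM hc (x := (m - j, 2)) (by simp only; omega) (by simp only; omega)
      (by simp only; omega) (by simp only; omega)).2.le,
      h.cellPos_notMem_range hM hc (by omega) (by omega) (Or.inr rfl)⟩
  · have h1 := fillLen_le_card_freePos (a := a) (s := s) hM hc hw m
    have h2 := mem_freePos_iff.1 (nth_mem_finset (freePos N M c w a s m) (n := j - m) (by omega))
    exact ⟨h2.1, h2.2.1⟩

theorem fillPos_inj (hM : 1 ≤ M) (hc : 6 < c)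
    (hw : ∑ i ∈ Finset.range N, w (i + 1) = c * M) {m : ℕ} :
    Function.Injective (fun j : Fin (fillLen N M c) => fillPos N M c w a s m j) := by
  have hk := k_eq c
  have hb : b c = 12 * c + 6 := rfl
  have h1 := fillLen_le_card_freePos (a := a) (s := s) hM hc hw m
  have key : ∀ i j : ℕ, i < j → j < fillLen N M c →
      fillPos N M c w a s m i ≠ fillPos N M c w a s m j := by
    intro i j hij hj
    unfold fillPos
    split_ifs with h2 h3
    · intro he
      have := congrArg Prod.fst (cellPos_inj (by simp only; omega) (by simp only; omega) he)
      simp only at this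
      omega
    · exact (mem_freePos_iff.1 (nth_mem_finset (freePos N M c w a s m) (n := j - m)
        (by omega))).2.2 _ (by omega) (by omega)
    · omega
    · exact (nth_finset_lt _ (by omega) (by omega)).ne
  intro i j he
  rcases lt_trichotomy (i : ℕ) j with h2 | h2 | h2
  · exact absurd he (key i j h2 j.2)
  · exact Fin.ext h2
  · exact absurd he.symm (key j i h2 i.2)

theorem Route.fillPos_near (h : Route N M c (fun q => w (q + 1)) a s) (hM : 1 ≤ M)
    (hc : 6 < c) (hw : ∑ i ∈ Finset.range N, w (i + 1) = c * M) {m j : ℕ}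
    (hj : j + 1 < fillLen N M c) :
    fillPos N M c w a s m j ≤ fillPos N M c w a s m (j + 1) + k c ∧
      fillPos N M c w a s m (j + 1) ≤ fillPos N M c w a s m j + k c := by
  have hk := k_eq c
  have hb : b c = 12 * c + 6 := rfl
  have h1 := fillLen_le_card_freePos (a := a) (s := s) hM hc hw m
  have hlow : ∀ n ∈ freePos N M c w a s m, 2 * k c ≤ n := by
    intro n hn
    by_contra! hlt
    obtain ⟨x, hx⟩ := exists_basePos_eq (N := N) (w := w) (a := a) (s := s) hM hc hlt
    exact (mem_freePos_iff.1 hn).2.1 x hx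
  rcases lt_trichotomy (j + 1) m with h2 | h2 | h2
  · rw [fillPos, if_pos (by omega), fillPos, if_pos h2]
    exact Near.cellPos_le (Or.inr (Or.inr ⟨by simp only; omega, le_rfl⟩)) (by simp only; omega)
      (by simp only; omega)
  · rw [fillPos, if_pos (by omega), fillPos, if_neg (by omega), h2, Nat.sub_self]
    have h3 := hlow _ (nth_mem_finset (freePos N M c w a s m) (n := 0) (by omega))
    have h4 : Nat.nth (· ∈ freePos N M c w a s m) 0 ≤ cellPos (k c) (1, 1) := by
      rw [Nat.nth_zero]
      exact Nat.sInf_le (h.one_mem_freePos hM hc le_rfl (by omega))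
    rw [show m - j = 1 by omega]
    unfold cellPos at *
    simp only at *
    omega
  · rw [fillPos, if_neg (by omega), fillPos, if_neg (by omega), show j + 1 - m = j - m + 1 by omega]
    have h3 := nth_finset_lt (freePos N M c w a s m) (Nat.lt_add_one (j - m)) (by omega)
    have h4 := hlow _ (nth_mem_finset (freePos N M c w a s m) (n := j - m) (by omega))
    have h5 := (mem_freePos_iff.1
      (nth_mem_finset (freePos N M c w a s m) (n := j - m + 1) (by omega))).1
    refine ⟨by omega, ?_⟩
    by_contra! hlt
    set n := Nat.nth (· ∈ freePos N M c w a s m) (j - m) with hn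
    have hkpos : 0 < k c := by omega
    obtain ⟨i, hi⟩ : ∃ i, n / k c = i + 2 :=
      ⟨n / k c - 2, by have := (Nat.le_div_iff_mul_le hkpos).2 h4; omega⟩
    have h6 := Nat.div_add_mod n (k c)
    have h7 := Nat.mod_lt n hkpos
    rw [hi, Nat.mul_comm, Nat.add_mul] at h6
    obtain ⟨i', h8, h9, h10⟩ : ∃ i', 1 ≤ i' ∧ n < cellPos (k c) (i', 1) ∧
        cellPos (k c) (i', 1) ≤ n + k c := by
      by_cases h0 : n % k c = 0
      · refine ⟨i + 1, by omega, ?_⟩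
        unfold cellPos
        simp only [Nat.add_mul, Nat.one_mul]
        omega
      · refine ⟨i + 2, by omega, ?_⟩
        unfold cellPos
        simp only [Nat.add_mul, Nat.one_mul]
        omega
    have h11 : i' + 4 ≤ 5 * M := by
      by_contra! h12
      have h13 : (5 * M - 3 + 1) * k c ≤ (i' + 1) * k c := Nat.mul_le_mul_right _ (by omega)
      have h14 := (apex_spec hM hc).1
      rw [Nat.add_mul] at h13
      unfold cellPos at *
      simp only at *
      omega
    have := Nat.le_nth_of_lt_nth_succ (p := (· ∈ freePos N M c w a s m)) (a := cellPos (k c) (i', 1))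
      (k := j - m) (by omega) (h.one_mem_freePos hM hc h8 h11)
    omega

/-- The vertices of the turning point other than `v_a`. -/
abbrev Turn (c : ℕ) : Type :=
  Fin 6 ⊕ Fin (3*((k c)-2)/2) ⊕ Fin (3*((k c)-2)/2) ⊕ (Fin (k c) × Fin 3)

/-- The distance of a vertex of the turning point to the right of `v_a`. -/
def turnPos (c : ℕ) : Turn c → ℕ :=
  Sum.elim ![k c, 2 * k c, 3 * k c, 2 * k c + 1, k c + 1, 1]
    (Sum.elim (fun h => if (h : ℕ) < k c - 2 then 2 * k c + 2 + h
        else k c + 2 + (k c - 2) / 2 + (h - (k c - 2)))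
      (Sum.elim (fun h => if (h : ℕ) < k c - 2 then 2 + h else k c + 2 + (h - (k c - 2)))
        (fun x => 3 * k c + 1 + x.2 * k c + x.1)))

theorem turnPos_pos (hc : 6 < c) (x : Turn c) : 0 < turnPos c x := by
  have hk := k_eq c
  have hb : b c = 12 * c + 6 := rfl
  rcases x with i | h | h | x
  · fin_cases i <;> simp [turnPos] <;> omega
  all_goals
    simp only [turnPos, Sum.elim_inl, Sum.elim_inr]
    (try split_ifs) <;> omega

theorem turnPos_inj (hc : 6 < c) : Function.Injective (turnPos c) := by
  have hk := k_eq c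
  have hb : b c = 12 * c + 6 := rfl
  obtain ⟨r, hr⟩ := even_k c
  have key : ∀ x : Fin (k c) × Fin 3,
      3 * k c < 3 * k c + 1 + x.2 * k c + x.1 := fun x => by omega
  have htp : ∀ i : Fin 6, turnPos c (Sum.inl i) ∈
      [k c, 2 * k c, 3 * k c, 2 * k c + 1, k c + 1, 1] := by
    intro i
    fin_cases i <;> simp [turnPos]
  refine Function.Injective.sumElim ?_ (Function.Injective.sumElim ?_
    (Function.Injective.sumElim ?_ ?_ ?_) ?_) ?_
  · intro i j
    fin_cases i <;> fin_cases j <;> simp <;> omega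
  · intro i j he
    simp only at he
    split_ifs at he <;> omega
  · intro i j he
    simp only at he
    split_ifs at he <;> omega
  · rintro ⟨i, l⟩ ⟨j, l'⟩ he
    fin_cases l <;> fin_cases l' <;> simp at he ⊢ <;> omega
  · intro i x he
    have := key x
    split_ifs at he <;> omega
  · rintro i (j | x) he <;> simp only [Sum.elim_inl, Sum.elim_inr] at he
    · split_ifs at he <;> omega
    · have := key x
      split_ifs at he <;> omega
  · intro i x he
    have h1 := htp i
    rw [turnPos, Sum.elim_inl, he] at h1
    simp only [List.mem_cons, List.not_mem_nil, or_false] at h1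
    rcases x with j | j | x <;> simp only [Sum.elim_inl, Sum.elim_inr] at h1
    · split_ifs at h1 <;> omega
    · split_ifs at h1 <;> omega
    · have := key x
      omega

/-- The vertices sorted into the three parts that are laid out separately. -/
def toParts : V N M c w → Base N M c w ⊕ Turn c ⊕ Fin (fillLen N M c) :=
  Sum.elim (fun x => .inl (.inl x)) <|
  Sum.elim (fun x => .inl (.inr (.inl x))) <|
  Sum.elim (fun x => .inl (.inr (.inr (.inl x)))) <|
  Sum.elim (fun x => .inr (.inl (.inl x))) <|
  Sum.elim (fun x => .inr (.inl (.inr (.inl x)))) <|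
  Sum.elim (fun x => .inr (.inl (.inr (.inr (.inl x))))) <|
  Sum.elim (fun x => .inr (.inl (.inr (.inr (.inr x))))) <|
  Sum.elim (fun x => .inl (.inr (.inr (.inr (.inl x))))) <|
  Sum.elim (fun x => .inl (.inr (.inr (.inr (.inr x))))) <|
  fun x => .inr (.inr x)

/-- The inverse of `toParts`. -/
def ofParts : Base N M c w ⊕ Turn c ⊕ Fin (fillLen N M c) → V N M c w :=
  Sum.elim
    (Sum.elim vp (Sum.elim vp0hair (Sum.elim vphair (Sum.elim vy vyhair))))
    (Sum.elim (Sum.elim vtp (Sum.elim vchair (Sum.elim vfhair vdhair))) vfill)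

theorem toParts_injective : Function.Injective (toParts (N := N) (M := M) (c := c) (w := w)) := by
  refine Function.LeftInverse.injective (g := ofParts) ?_
  rintro (_ | _ | _ | _ | _ | _ | _ | _ | _ | _) <;> rfl

/-- The position of each vertex, for a filler path starting in bucket `m`. -/
noncomputable def layout (a s : ℕ → ℕ) (m : ℕ) (v : V N M c w) : ℕ :=
  Sum.elim (basePos a s)
    (Sum.elim (fun x => apex M c + turnPos c x) (fun j : Fin (fillLen N M c) => fillPos N M c w a s m j))
    (toParts v)

theorem Route.layout_inj (h : Route N M c (fun q => w (q + 1)) a s) (hM : 1 ≤ M) (hc : 6 < c)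
    (hw : ∑ i ∈ Finset.range N, w (i + 1) = c * M) {m : ℕ} (hm : m + 4 ≤ 5 * M) :
    Function.Injective (layout (N := N) (M := M) (c := c) (w := w) a s m) := by
  refine Function.Injective.comp (Function.Injective.sumElim (h.basePos_inj hM hc)
    (Function.Injective.sumElim ?_ (fillPos_inj hM hc hw) ?_) ?_) toParts_injective
  · intro x y he
    exact turnPos_inj hc (Nat.add_left_cancel he)
  · intro x j
    have h1 := turnPos_pos hc x
    have h2 := (h.fillPos_spec hM hc hw hm j.2).1
    omega
  · rintro x (y | j)
    · have h1 := turnPos_pos hc y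
      have h2 := h.basePos_le hM hc x
      simp only [Sum.elim_inl]
      omega
    · exact (h.fillPos_spec hM hc hw hm j.2).2 x

theorem Route.near_cell (h : Route N M c (fun q => w (q + 1)) a s) (n n' : Fin (6 * N - 5))
    (hn : (n' : ℕ) = n + 1) :
    Near (midCell (M := M) (c := c) (w := w) a s (.inr (.inl n)))
      (midCell (M := M) (c := c) (w := w) a s (.inr (.inl n'))) := by
  simp only [midCell, Sum.elim_inl, Sum.elim_inr]
  by_cases h5 : (n : ℕ) % 6 = 5
  · rw [h5, show (n' : ℕ) / 6 = n / 6 + 1 by omega, show (n' : ℕ) % 6 = 0 by omega]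
    exact h.yCell_near_succ (by omega)
  · rw [show (n' : ℕ) / 6 = n / 6 by omega, show (n' : ℕ) % 6 = n % 6 + 1 by omega]
    exact h.yCell_near (by omega) (by omega)

theorem Route.layout_adj (h : Route N M c (fun q => w (q + 1)) a s) (hN : 1 ≤ N) (hM : 1 ≤ M)
    (hc : 6 < c) (hw : ∑ i ∈ Finset.range N, w (i + 1) = c * M) (h0 : a 0 = M - 1)
    {u v : V N M c w} (huv : Adj N M c w u v) :
    layout a s (5 * a (N - 1) + 1) u ≤ layout a s (5 * a (N - 1) + 1) v + k c ∧
    layout a s (5 * a (N - 1) + 1) v ≤ layout a s (5 * a (N - 1) + 1) u + k c := by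
  have hk := k_eq c
  have hb : b c = 12 * c + 6 := rfl
  obtain ⟨r, hr⟩ := even_k c
  obtain ⟨hX, hX'⟩ := apex_spec hM hc
  have hmid : ∀ x : Mid N M c w, (midCell a s x).2 < k c := fun x => (h.midCell_bounds x).2.2.2.1
  have hlast : 5 * a (N - 1) + 1 + 4 ≤ 5 * M := by have := h.lt (N - 1) (by omega); omega
  cases huv with
  | spine i j hij =>
    change min ((i + 1) * k c) (apex M c) ≤ min ((j + 1) * k c) (apex M c) + k c ∧
      min ((j + 1) * k c) (apex M c) ≤ min ((i + 1) * k c) (apex M c) + k c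
    have : ((j : ℕ) + 1) * k c = (i + 1) * k c + k c := by rw [hij]; ring
    omega
  | hair0 m i hi =>
    change (if (m : ℕ) < k c then (m : ℕ) else m + 1) ≤ min ((i + 1) * k c) (apex M c) + k c ∧
      min ((i + 1) * k c) (apex M c) ≤ (if (m : ℕ) < k c then (m : ℕ) else m + 1) + k c
    rw [hi]
    split_ifs <;> omega
  | phairE i' t m i hi =>
    change cellPos (k c) (phairCell c (i', t, m)) ≤ min ((i + 1) * k c) (apex M c) + k c ∧
      min ((i + 1) * k c) (apex M c) ≤ cellPos (k c) (phairCell c (i', t, m)) + k c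
    rcases spine_pos hM hc i with ⟨h1, h2, -⟩ | ⟨h1, -⟩
    · rw [h2]
      refine Near.cellPos_le ?_ (phairCell_bounds (i', t, m)).2.2.2.2 (by simp only; omega)
      unfold phairCell Near
      cases t <;> simp only [cond] at hi ⊢ <;> split_ifs <;> omega
    · cases t <;> simp only [cond] at hi <;> omega
  | tpEnter i hi =>
    change min ((i + 1) * k c) (apex M c) ≤ apex M c + k c + k c ∧
      apex M c + k c ≤ min ((i + 1) * k c) (apex M c) + k c
    rcases spine_pos hM hc i with ⟨h1, -⟩ | ⟨-, h2⟩ <;> omega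
  | tpSpine i j hij =>
    change apex M c + ![k c, 2 * k c, 3 * k c, 2 * k c + 1, k c + 1, 1] i ≤
        apex M c + ![k c, 2 * k c, 3 * k c, 2 * k c + 1, k c + 1, 1] j + k c ∧
      apex M c + ![k c, 2 * k c, 3 * k c, 2 * k c + 1, k c + 1, 1] j ≤
        apex M c + ![k c, 2 * k c, 3 * k c, 2 * k c + 1, k c + 1, 1] i + k c
    fin_cases i <;> fin_cases j <;> simp at hij ⊢ <;> omega
  | chairE m =>
    change apex M c + (if (m : ℕ) < k c - 2 then 2 * k c + 2 + m
        else k c + 2 + (k c - 2) / 2 + (m - (k c - 2))) ≤ apex M c + 2 * k c + k c ∧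
      apex M c + 2 * k c ≤ apex M c + (if (m : ℕ) < k c - 2 then 2 * k c + 2 + m
        else k c + 2 + (k c - 2) / 2 + (m - (k c - 2))) + k c
    split_ifs <;> omega
  | fhairE m =>
    change apex M c + (if (m : ℕ) < k c - 2 then 2 + (m : ℕ) else k c + 2 + (m - (k c - 2))) ≤
        apex M c + (k c + 1) + k c ∧
      apex M c + (k c + 1) ≤
        apex M c + (if (m : ℕ) < k c - 2 then 2 + (m : ℕ) else k c + 2 + (m - (k c - 2))) + k c
    split_ifs <;> omega
  | dhair0 m =>
    change apex M c + (3 * k c + 1 + 0 * k c + m) ≤ apex M c + 3 * k c + k c ∧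
      apex M c + 3 * k c ≤ apex M c + (3 * k c + 1 + 0 * k c + m) + k c
    omega
  | dpath m l l' hl =>
    change apex M c + (3 * k c + 1 + l * k c + m) ≤
        apex M c + (3 * k c + 1 + l' * k c + m) + k c ∧
      apex M c + (3 * k c + 1 + l' * k c + m) ≤
        apex M c + (3 * k c + 1 + l * k c + m) + k c
    have : (l' : ℕ) * k c = l * k c + k c := by rw [hl]; ring
    omega
  | yEnter i hi =>
    change apex M c + 1 ≤ cellPos (k c) (yCell a s c (i / 6) (i % 6)) + k c ∧
      cellPos (k c) (yCell a s c (i / 6) (i % 6)) ≤ apex M c + 1 + k c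
    have h1 : cellPos (k c) (yCell a s c (i / 6) (i % 6)) < apex M c :=
      (h.midPos_bounds hM hc (.inr (.inl i))).2
    have h2 : yCell a s c (i / 6) (i % 6) = (5 * (M - 1) + 1, 3 + s 0) := by
      rw [hi]
      simp [yCell, h0]
    rw [h2] at h1 ⊢
    have h3 : (5 * (M - 1) + 1 + 1) * k c = (5 * M - 3) * k c := by
      rw [show 5 * (M - 1) + 1 + 1 = 5 * M - 3 by omega]
    unfold cellPos at *
    simp only at *
    omega
  | ySpine i j hij => exact (h.near_cell (M := M) i j hij).cellPos_le (hmid _) (hmid _)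
  | yhairE x m hm =>
    refine Near.cellPos_le (x := midCell a s (.inr (.inr x))) (y := midCell a s (.inr (.inl m)))
      (Or.inl ?_) (hmid (.inr (.inr x))) (hmid (.inr (.inl m)))
    have h1 : (m : ℕ) / 6 = x.1 := by omega
    have h2 : (m : ℕ) % 6 = 0 := by omega
    simp [midCell, yhairCell, yCell, h1, h2]
  | fillEnter m j hm hj =>
    change cellPos (k c) (midCell (M := M) (c := c) (w := w) a s (.inr (.inl m))) ≤
        fillPos N M c w a s (5 * a (N - 1) + 1) j + k c ∧
      fillPos N M c w a s (5 * a (N - 1) + 1) j ≤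
        cellPos (k c) (midCell (M := M) (c := c) (w := w) a s (.inr (.inl m))) + k c
    rw [fillPos, if_pos (by omega)]
    refine Near.cellPos_le (Or.inl ?_) (hmid (.inr (.inl m))) (by simp only; omega)
    have h1 : (m : ℕ) / 6 = N - 1 := by omega
    have h2 : (m : ℕ) % 6 = 0 := by omega
    simp [midCell, yCell, h1, h2, hj]
  | fillPath j j' hj =>
    change fillPos N M c w a s (5 * a (N - 1) + 1) j ≤
        fillPos N M c w a s (5 * a (N - 1) + 1) j' + k c ∧
      fillPos N M c w a s (5 * a (N - 1) + 1) j' ≤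
        fillPos N M c w a s (5 * a (N - 1) + 1) j + k c
    have := j'.2
    rw [hj] at this ⊢
    exact h.fillPos_near hM hc hw this

theorem bandwidthLE_of_route (h : Route N M c (fun q => w (q + 1)) a s) (hN : 1 ≤ N)
    (hM : 1 ≤ M) (hc : 6 < c) (hw : ∑ i ∈ Finset.range N, w (i + 1) = c * M)
    (h0 : a 0 = M - 1) : BandwidthLE (catG N M c w) (k c) := by
  have hlast : 5 * a (N - 1) + 1 + 4 ≤ 5 * M := by have := h.lt (N - 1) (by omega); omega
  refine bandwidthLE_of_injective _ _ (layout a s (5 * a (N - 1) + 1))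
    (h.layout_inj hM hc hw hlast) ?_
  intro u v huv
  rcases ((SimpleGraph.fromRel_adj _ u v).1 huv).2 with h1 | h1
  · exact (h.layout_adj hN hM hc hw h0 h1).1
  · exact (h.layout_adj hN hM hc hw h0 h1).2

end

/-- A uniform emulation, shifted to start counting at zero, yields a route in which a weighted
vertex is identified by the total weight of its predecessors in the same chamber. -/
theorem route_of_isUniformEmulation {N M c : ℕ} {w f : ℕ → ℕ}
    (hw : ∀ i ∈ Finset.Icc 1 N, 0 < w i) (hf : IsUniformEmulation N M c w f) :
    Route N M c (fun q => w (q + 1)) (fun q => f (q + 1) - 1)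
      (fun q => ∑ i ∈ (Finset.range q).filter (fun i => f (i + 1) = f (q + 1)), w (i + 1)) := by
  obtain ⟨h1, h2, h3⟩ := hf
  have hmem : ∀ q, q < N → 1 ≤ f (q + 1) ∧ f (q + 1) ≤ M := fun q hq =>
    Finset.mem_Icc.1 (h1 (q + 1) (Finset.mem_Icc.2 ⟨by omega, by omega⟩))
  have hsucc : ∀ q, (∑ i ∈ (Finset.range q).filter (fun i => f (i + 1) = f (q + 1)), w (i + 1)) +
      w (q + 1) =
      ∑ i ∈ (Finset.range (q + 1)).filter (fun i => f (i + 1) = f (q + 1)), w (i + 1) := by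
    intro q
    rw [Finset.range_add_one, Finset.filter_insert, if_pos rfl, Finset.sum_insert (by simp),
      Nat.add_comm]
  refine ⟨fun q hq => ?_, fun q hq => ?_, fun q hq => ?_, fun q hq => ?_,
    fun q q' hlt hq' ha => ?_⟩
  · have := hmem q hq; omega
  · have h4 := hmem q (by omega)
    have h5 := hmem (q + 1) hq
    have h6 := abs_le.1 (h2 (q + 1) (by omega) hq)
    omega
  · exact hw _ (Finset.mem_Icc.2 ⟨by omega, by omega⟩)
  · rw [hsucc, ← h3 (f (q + 1)) (Finset.mem_Icc.2 (hmem q hq)),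
      ← Finset.sum_image (g := (· + 1)) (f := w) (by simp)]
    refine Finset.sum_le_sum_of_subset fun i hi => ?_
    simp only [Finset.mem_image, Finset.mem_filter, Finset.mem_range] at hi
    obtain ⟨j, ⟨hj, hj'⟩, rfl⟩ := hi
    simp only [Finset.mem_filter, Finset.mem_Icc]
    exact ⟨⟨by omega, by omega⟩, hj'⟩
  · have h4 := hmem q (by omega)
    have h5 := hmem q' hq'
    have h6 : f (q + 1) = f (q' + 1) := by omega
    rw [hsucc, h6]
    exact Finset.sum_le_sum_of_subset (Finset.filter_subset_filter _
      (Finset.range_subset_range.2 (by omega)))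

end Caterpillar

open Caterpillar in
/-- if `P_N` with weights `w` has a uniform emulation `f` on `P_M` with
emulation factor `c` and `f(1) = M`, then the caterpillar `G` has bandwidth at most
`k = 9bc + b` (where `b = 12c + 6`). -/
theorem stmt_2 (N M c : ℕ) (hN : 1 ≤ N) (hM : 1 ≤ M) (hc : 6 < c)
    (w : ℕ → ℕ) (hw : ∀ i ∈ Finset.Icc 1 N, 0 < w i)
    (hsum : ∑ i ∈ Finset.Icc 1 N, w i = c * M)
    (f : ℕ → ℕ) (hf : IsUniformEmulation N M c w f) (hf1 : f 1 = M) :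
    BandwidthLE (catG N M c w) (k c) := by
  refine bandwidthLE_of_route (route_of_isUniformEmulation hw hf) hN hM hc ?_ (by simp [hf1])
  rw [← hsum, Finset.range_eq_Ico, Finset.sum_Ico_add' w 0 N 1]
  rfl
end

section
/- Let N, M, c be positive integers with c > 6, let w: {1,…,N} → ℤ⁺ satisfy Σ_{i=1}^N w(i) = cM, set b = 12c+6 and k = 9bc+b, and let G be the caterpillar constructed from this data as described. If the bandwidth of G is at most k, then P_N with weights w has a uniform emulation f on P_M with emulation factor c such that f(1) = M. -/
section Counting

theorem card_le_of_mem_Icc {α : Type*} {φ : α → ℤ} (hφ : Function.Injective φ) (S : Finset α)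
    {l u : ℤ} (h : ∀ x ∈ S, φ x ∈ Finset.Icc l u) : S.card ≤ (u + 1 - l).toNat := by
  rw [← Int.card_Icc]
  exact Finset.card_le_card_of_injOn φ h hφ.injOn

theorem exists_eq_of_card_eq {α : Type*} [Fintype α] {φ : α → ℤ} (hφ : Function.Injective φ)
    {l u : ℤ} (h : ∀ x, φ x ∈ Finset.Icc l u) (hcard : (u + 1 - l).toNat ≤ Fintype.card α)
    {z : ℤ} (hz : z ∈ Finset.Icc l u) : ∃ x, φ x = z := by
  have := Finset.surj_on_of_inj_on_of_card_le (s := Finset.univ) (t := Finset.Icc l u)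
    (fun x _ => φ x) (fun x _ => h x) (fun x y _ _ e => hφ e)
    (by rw [Int.card_Icc]; exact hcard) z hz
  obtain ⟨x, -, hx⟩ := this
  exact ⟨x, hx.symm⟩

theorem sum_Icc_one_eq_sum_fin (N : ℕ) (f : ℕ → ℕ) :
    ∑ i ∈ Finset.Icc 1 N, f i = ∑ i : Fin N, f (i.1 + 1) := by
  rw [Fin.sum_univ_eq_sum_range (fun i => f (i + 1)), Finset.range_eq_Ico,
    Finset.sum_Ico_add' f 0 N 1]
  rfl

theorem card_filter_sigma (N m : ℕ) (w : ℕ → ℕ) (p : ℕ → Prop) [DecidablePred p] :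
    (Finset.univ.filter (fun x : (i : Fin N) × Fin (m * w (i.1 + 1)) => p (x.1.1 + 1))).card =
      m * ∑ i ∈ (Finset.Icc 1 N).filter p, w i := by
  rw [Finset.card_filter, Fintype.sum_sigma, Finset.sum_filter, Finset.mul_sum,
    sum_Icc_one_eq_sum_fin]
  refine Finset.sum_congr rfl fun i _ => ?_
  by_cases h : p (i.1 + 1) <;> simp [h]

end Counting

section Emulation

variable {M : ℕ} {K : ℤ} {a : ℕ → ℤ}

theorem le_add_mul_of_step (has : ∀ m < 5 * M, a (m + 1) ≤ a m + K) {m n : ℕ} (hmn : m ≤ n)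
    (hn : n ≤ 5 * M) : a n ≤ a m + (n - m) * K := by
  induction n, hmn using Nat.le_induction with
  | base => simp
  | succ n hmn ih =>
    have h1 := ih (by omega)
    have h2 := has n (by omega)
    push_cast
    linarith

theorem spine_bounds (ha0 : a 0 = K) (haM : a (5 * M) = (5 * M + 1) * K - 2)
    (has : ∀ m < 5 * M, a (m + 1) ≤ a m + K) {m : ℕ} (hm : m ≤ 5 * M) :
    (m + 1) * K - 2 ≤ a m ∧ a m ≤ (m + 1) * K := by
  have h1 := le_add_mul_of_step has (Nat.zero_le m) hm
  have h2 := le_add_mul_of_step has hm le_rfl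
  rw [ha0] at h1
  rw [haM] at h2
  push_cast at h1 h2
  constructor <;> linarith

/-- A position strictly between the first and the last window lies in a gap between the windows
around `a (5 * j)` and `a (5 * j + 3)`, or in the block formed by the windows around
`a (5 * j + 3)` and `a (5 * j + 5)`. -/
theorem gap_or_block (hM : 1 ≤ M) {x : ℤ} (hlo : a 0 + K < x) (hhi : x < a (5 * M - 2) - K) :
    (∃ j < M, a (5 * j) + K < x ∧ x < a (5 * j + 3) - K) ∨
      ∃ j, j + 1 < M ∧ a (5 * j + 3) - K ≤ x ∧ x ≤ a (5 * j + 5) + K := by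
  by_contra! hcon
  obtain ⟨hgap, hblock⟩ := hcon
  have key : ∀ j < M, a (5 * j) + K < x := by
    intro j
    induction j with
    | zero => intro _; simpa using hlo
    | succ j ih =>
      intro hj
      exact hblock j hj (hgap j (by omega) (ih (by omega)))
  have h := hgap (M - 1) (by omega) (key _ (by omega))
  rw [show 5 * (M - 1) + 3 = 5 * M - 2 by omega] at h
  exact absurd hhi (not_lt.mpr h)

theorem exists_emulation {N c B : ℕ} {w : ℕ → ℕ} (hM : 1 ≤ M) (hN : 1 ≤ N) (hB : 0 < B)
    (hK : K = 9 * B * c + B) (hK2 : 2 < K)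
    (hw : ∀ i ∈ Finset.Icc 1 N, 0 < w i) (hsum : ∑ i ∈ Finset.Icc 1 N, w i = c * M)
    {φ : ((i : Fin N) × Fin (9 * B * w (i.1 + 1))) → ℤ} (hφ : Function.Injective φ)
    {Y : ℕ → ℤ} (hY : ∀ x, |φ x - Y x.1| ≤ K)
    (hYstep : ∀ i, i + 1 < N → |Y (i + 1) - Y i| ≤ 6 * K)
    (hY0 : (5 * M - 3) * K - 2 ≤ Y 0)
    (ha0 : a 0 = K) (haM : a (5 * M) = (5 * M + 1) * K - 2)
    (has : ∀ m < 5 * M, a (m + 1) ≤ a m + K)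
    (hlo : ∀ x, a 0 + K < φ x) (hhi : ∀ x, φ x < a (5 * M - 2) - K)
    (hq : ∀ j < M, (Finset.univ.filter (fun x => |φ x - a (5 * j)| ≤ K)).card ≤ 2 * B)
    (hr : ∀ j < M, (Finset.univ.filter (fun x => |φ x - a (5 * j + 3)| ≤ K)).card ≤ 2 * B) :
    ∃ f : ℕ → ℕ, IsUniformEmulation N M c w f ∧ f 1 = M := by
  classical
  have hb : ∀ m ≤ 5 * M, (m + 1) * K - 2 ≤ a m ∧ a m ≤ (m + 1) * K := fun m hm =>
    spine_bounds ha0 haM has hm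
  have mulK : ∀ {s t : ℤ}, s ≤ t → s * K ≤ t * K := fun h =>
    mul_le_mul_of_nonneg_right h (by omega)
  have hblockcard : ∀ j, j + 1 < M → (Finset.univ.filter
      (fun x => a (5 * j + 3) - K ≤ φ x ∧ φ x ≤ a (5 * j + 5) + K)).card ≤ 4 * B := by
    intro j hj
    have h1 := hr j (by omega)
    have h2 := hq (j + 1) hj
    have h3 : a (5 * j + 4) ≤ a (5 * j + 3) + K := has _ (by omega)
    have h4 : a (5 * j + 5) ≤ a (5 * j + 4) + K := has _ (by omega)
    calc _ ≤ ((Finset.univ.filter (fun x => |φ x - a (5 * j + 3)| ≤ K)) ∪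
          (Finset.univ.filter (fun x => |φ x - a (5 * (j + 1))| ≤ K))).card := by
          refine Finset.card_le_card fun x hx => ?_
          simp only [Finset.mem_filter, Finset.mem_univ, true_and, Finset.mem_union,
            abs_le, show 5 * (j + 1) = 5 * j + 5 by ring] at hx ⊢
          omega
      _ ≤ _ := Finset.card_union_le _ _
      _ ≤ 4 * B := by omega
  have hex : ∀ i : Fin N, ∃ j < M, ∃ h : Fin (9 * B * w (i.1 + 1)),
      a (5 * j) + K < φ ⟨i, h⟩ ∧ φ ⟨i, h⟩ < a (5 * j + 3) - K := by
    intro i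
    by_contra! hcon
    have hbl : ∀ h : Fin (9 * B * w (i.1 + 1)), ∃ j, j + 1 < M ∧
        a (5 * j + 3) - K ≤ φ ⟨i, h⟩ ∧ φ ⟨i, h⟩ ≤ a (5 * j + 5) + K := by
      intro h
      rcases gap_or_block hM (hlo ⟨i, h⟩) (hhi ⟨i, h⟩) with ⟨j, hj, h1, h2⟩ | h1
      · exact absurd h2 (not_lt.mpr (hcon j hj h h1))
      · exact h1
    have hwi : 0 < w (i.1 + 1) := hw _ (by simp [i.2])
    have hpos : 0 < 9 * B * w (i.1 + 1) := by positivity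
    obtain ⟨h0, -, hmin⟩ := Finset.exists_min_image Finset.univ (fun h => φ ⟨i, h⟩)
      ⟨(⟨0, hpos⟩ : Fin (9 * B * w (i.1 + 1))), Finset.mem_univ _⟩
    obtain ⟨j0, hj0, hl0, hu0⟩ := hbl h0
    let block (j : ℕ) := Finset.univ.filter
      (fun x => a (5 * j + 3) - K ≤ φ x ∧ φ x ≤ a (5 * j + 5) + K)
    have hsub : ∀ h, (⟨i, h⟩ : (i : Fin N) × Fin (9 * B * w (i.1 + 1))) ∈ block j0 ∨
        (j0 + 2 < M ∧
          (⟨i, h⟩ : (i : Fin N) × Fin (9 * B * w (i.1 + 1))) ∈ block (j0 + 1)) := by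
      intro h
      obtain ⟨j, hj, hl, hu⟩ := hbl h
      have hm := hmin h (Finset.mem_univ _)
      have e1 := abs_le.mp (hY ⟨i, h⟩)
      have e2 := abs_le.mp (hY ⟨i, h0⟩)
      simp only at hm e1 e2
      have hj1 : j0 ≤ j := by
        by_contra! hlt
        have b1 := (hb (5 * j + 5) (by omega)).2
        have b2 := (hb (5 * j0 + 3) (by omega)).1
        have := mulK (s := 5 * j + 10) (t := 5 * j0 + 5) (by omega)
        push_cast at b1 b2
        linarith
      have hj2 : j ≤ j0 + 1 := by
        by_contra! hlt
        have b1 := (hb (5 * j0 + 5) (by omega)).2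
        have b2 := (hb (5 * j + 3) (by omega)).1
        have := mulK (s := 5 * j0 + 10) (t := 5 * j) (by omega)
        push_cast at b1 b2
        linarith
      have hmem : (⟨i, h⟩ : (i : Fin N) × Fin (9 * B * w (i.1 + 1))) ∈ block j :=
        Finset.mem_filter.mpr ⟨Finset.mem_univ _, hl, hu⟩
      rcases (by omega : j = j0 ∨ j = j0 + 1) with rfl | rfl
      · exact Or.inl hmem
      · exact Or.inr ⟨hj, hmem⟩
    have hcard : 9 * B * w (i.1 + 1) ≤ 8 * B := by
      have himg : (Finset.univ.image (fun h : Fin (9 * B * w (i.1 + 1)) =>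
          (⟨i, h⟩ : (i : Fin N) × Fin (9 * B * w (i.1 + 1))))).card = 9 * B * w (i.1 + 1) := by
        rw [Finset.card_image_of_injective _ sigma_mk_injective]; simp
      rw [← himg]
      have c0 : (block j0).card ≤ 4 * B := hblockcard j0 hj0
      by_cases hj : j0 + 2 < M
      · have c1 : (block (j0 + 1)).card ≤ 4 * B := hblockcard (j0 + 1) hj
        calc _ ≤ (block j0 ∪ block (j0 + 1)).card := by
              refine Finset.card_le_card fun x hx => ?_
              obtain ⟨h, -, rfl⟩ := Finset.mem_image.mp hx
              exact Finset.mem_union.mpr ((hsub h).imp id And.right)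
          _ ≤ _ := Finset.card_union_le _ _
          _ ≤ _ := by omega
      · calc _ ≤ (block j0).card := by
              refine Finset.card_le_card fun x hx => ?_
              obtain ⟨h, -, rfl⟩ := Finset.mem_image.mp hx
              exact (hsub h).resolve_right fun h => hj h.1
          _ ≤ _ := by omega
    nlinarith
  choose F hFM H hHl hHu using hex
  let f : ℕ → ℕ := fun i => if h : i - 1 < N then F ⟨i - 1, h⟩ + 1 else 0
  have hf : ∀ i : Fin N, f (i.1 + 1) = F i + 1 := fun i => by simp [f, i.2]
  have hclose : ∀ i i' : Fin N, Y i.1 - Y i'.1 ≤ 6 * K → F i ≤ F i' + 1 := by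
    intro i i' hii
    by_contra! hlt
    have b1 := (hb (5 * F i) (by have := hFM i; omega)).1
    have b2 := (hb (5 * F i' + 3) (by have := hFM i'; omega)).2
    have e1 := abs_le.mp (hY ⟨i, H i⟩)
    have e2 := abs_le.mp (hY ⟨i', H i'⟩)
    have e3 := hHl i
    have e4 := hHu i'
    have := mulK (s := 5 * F i' + 10) (t := 5 * F i) (by omega)
    push_cast at b1 b2
    simp only at e1 e2
    linarith
  have hle : ∀ j ∈ Finset.Icc 1 M,
      ∑ i ∈ (Finset.Icc 1 N).filter (fun i => f i = j), w i ≤ c := by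
    intro j hj
    obtain ⟨hj1, hjM⟩ := Finset.mem_Icc.mp hj
    obtain ⟨j, rfl⟩ := Nat.exists_eq_add_of_le' hj1
    have hcard := card_filter_sigma N (9 * B) w (fun i => f i = j + 1)
    have hsub : (Finset.univ.filter (fun x : (i : Fin N) × Fin (9 * B * w (i.1 + 1)) =>
        f (x.1.1 + 1) = j + 1)) ⊆
        (Finset.univ.filter (fun x => |φ x - a (5 * j)| ≤ K)) ∪
        ((Finset.univ.filter (fun x => |φ x - a (5 * j + 3)| ≤ K)) ∪
        (Finset.univ.filter (fun x => φ x ∈ Finset.Icc (a (5 * j) + K + 1)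
          (a (5 * j + 3) - K - 1)))) := by
      intro x hx
      simp only [Finset.mem_filter, Finset.mem_univ, true_and, hf, Nat.add_right_cancel_iff] at hx
      have e1 := abs_le.mp (hY x)
      have e2 := abs_le.mp (hY ⟨x.1, H x.1⟩)
      have e3 := hHl x.1
      have e4 := hHu x.1
      rw [hx] at e3 e4
      simp only [Finset.mem_filter, Finset.mem_univ, true_and, Finset.mem_union, Finset.mem_Icc,
        abs_le] at e2 ⊢
      omega
    have h1 := (Finset.card_le_card hsub).trans
      ((Finset.card_union_le _ _).trans (Nat.add_le_add_left (Finset.card_union_le _ _) _))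
    have h2 := card_le_of_mem_Icc hφ
      (Finset.univ.filter (fun x => φ x ∈ Finset.Icc (a (5 * j) + K + 1)
          (a (5 * j + 3) - K - 1))) (fun x hx => (Finset.mem_filter.mp hx).2)
    have h3 := hq j (by omega)
    have h4 := hr j (by omega)
    have h5 := le_add_mul_of_step has (show 5 * j ≤ 5 * j + 3 by omega) (by omega)
    push_cast at h5
    rw [hcard] at h1
    generalize ∑ i ∈ (Finset.Icc 1 N).filter (fun i => f i = j + 1), w i = S at h1 ⊢
    have h6 : ((9 * B * S : ℕ) : ℤ) ≤
        4 * B + (K - 1) := by omega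
    rw [hK] at h6
    have h7 : 9 * B * S < 9 * B * (c + 1) := by
      zify
      push_cast at h6
      nlinarith
    exact Nat.lt_succ_iff.mp (lt_of_mul_lt_mul_left h7 (Nat.zero_le _))
  have hmaps : ∀ i ∈ Finset.Icc 1 N, f i ∈ Finset.Icc 1 M := by
    intro i hi
    obtain ⟨hi1, hiN⟩ := Finset.mem_Icc.mp hi
    have h := hf ⟨i - 1, by omega⟩
    have h' := hFM ⟨i - 1, by omega⟩
    simp only [Nat.sub_add_cancel hi1] at h
    rw [h, Finset.mem_Icc]
    omega
  refine ⟨f, ⟨hmaps, ?_, ?_⟩, ?_⟩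
  · intro i hi1 hiN
    obtain ⟨i, rfl⟩ := Nat.exists_eq_add_of_le' hi1
    have h1 := hf ⟨i, by omega⟩
    have h2 := hf ⟨i + 1, by omega⟩
    simp only at h1 h2
    have h3 := abs_le.mp (hYstep i hiN)
    have h4 := hclose ⟨i, by omega⟩ ⟨i + 1, by omega⟩ (by simp only; omega)
    have h5 := hclose ⟨i + 1, by omega⟩ ⟨i, by omega⟩ (by simp only; omega)
    rw [h1, h2, abs_le]
    omega
  · have htot : ∑ j ∈ Finset.Icc 1 M, ∑ i ∈ (Finset.Icc 1 N).filter (fun i => f i = j), w i =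
        ∑ j ∈ Finset.Icc 1 M, c := by
      rw [Finset.sum_fiberwise_of_maps_to hmaps, hsum]
      simp [mul_comm]
    exact (Finset.sum_eq_sum_iff_of_le hle).mp htot
  · have h1 := hf ⟨0, hN⟩
    simp only [Nat.zero_add] at h1
    rw [h1]
    by_contra hne
    have hF := hFM ⟨0, hN⟩
    have e1 := abs_le.mp (hY ⟨⟨0, hN⟩, H ⟨0, hN⟩⟩)
    have e2 := hHu ⟨0, hN⟩
    have e3 := (hb (5 * F ⟨0, hN⟩ + 3) (by omega)).2
    have := mulK (s := 5 * F ⟨0, hN⟩ + 10) (t := 5 * M) (by omega)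
    push_cast at e3
    simp only at e1
    linarith

end Emulation

namespace Caterpillar

variable {N M c : ℕ} {w : ℕ → ℕ}

theorem two_dvd_k (c : ℕ) : 2 ∣ k c := ⟨(6 * c + 3) * (9 * c + 1), by unfold k b; ring⟩

theorem le_k (hc : 6 < c) : 90 ≤ k c := by
  unfold k b
  have := Nat.zero_le (9 * (12 * c + 6) * c)
  omega

theorem fillLen_add (hM : 1 ≤ M) (hN : 1 ≤ N) (hNM : N ≤ c * M) :
    fillLen N M c + ((5 * M - 2) + (2 * k c - 1) + 2 * (M - 1) * (2 * k c - 2 * b c) +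
      (6 * N - 5) + 9 * b c * c * M) + 1 = (5 * M - 2) * k c := by
  obtain ⟨M, rfl⟩ := Nat.exists_eq_add_of_le' hM
  have hB : b c = 12 * c + 6 := rfl
  have hk : k c = 9 * (b c * c) + b c := by unfold k; ring
  have e0 : 5 * (M + 1) - 2 = 5 * M + 3 := by omega
  have e1 : 2 * k c - 2 * b c = 18 * (b c * c) := by omega
  have e2 : (5 * M + 3) * k c =
      45 * (M * (b c * c)) + 5 * (M * b c) + 27 * (b c * c) + 3 * b c := by rw [hk]; ring
  have e3 : 2 * M * (18 * (b c * c)) = 36 * (M * (b c * c)) := by ring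
  have e4 : 9 * b c * c * (M + 1) = 9 * (M * (b c * c)) + 9 * (b c * c) := by ring
  have e5 : M * b c = 12 * (c * M) + 6 * M := by rw [hB]; ring
  rw [Nat.mul_add] at hNM
  unfold fillLen
  rw [Nat.add_sub_cancel, e0, e1, e2, e3, e4]
  omega

theorem card_V (hM : 1 ≤ M) (hN : 1 ≤ N) (hNM : N ≤ c * M)
    (hsum : ∑ i ∈ Finset.Icc 1 N, w i = c * M) :
    (Fintype.card (V N M c w) : ℤ) = (5 * M + 4) * k c - 1 := by
  have hcard : Fintype.card (V N M c w) = (5 * M - 2) + ((2 * k c - 1) +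
      ((M - 1) * (2 * (2 * k c - 2 * b c)) + (6 + (3 * (k c - 2) / 2 + (3 * (k c - 2) / 2 +
      (k c * 3 + ((6 * N - 5) + (9 * b c * (c * M) + fillLen N M c)))))))) := by
    rw [← hsum, Finset.mul_sum, sum_Icc_one_eq_sum_fin]
    change @Fintype.card (_ ⊕ _) _ = _
    simp
  have hfill := fillLen_add hM hN hNM
  have h2 := two_dvd_k c
  have hk0 : 0 < k c := by unfold k b; positivity
  have e1 : (M - 1) * (2 * (2 * k c - 2 * b c)) = 2 * (M - 1) * (2 * k c - 2 * b c) := by ring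
  have e2 : 9 * b c * (c * M) = 9 * b c * c * M := by ring
  have e3 : ((5 * M - 2 : ℕ) : ℤ) = 5 * M - 2 := by omega
  have e4 : (((5 * M - 2) * k c : ℕ) : ℤ) = (5 * M - 2) * k c := by rw [Nat.cast_mul, e3]
  have e5 : ((5 * M + 4) * k c - 1 : ℤ) = (((5 * M - 2) * k c : ℕ) : ℤ) + 6 * k c - 1 := by
    rw [e4]; ring
  rw [e5, hcard, e1, e2]
  omega

/-- `g` numbers the vertices of `G` by `0, 1, …` so that adjacent vertices get numbers at
distance at most `k`. -/
structure IsLayout (g : V N M c w → ℤ) : Prop where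
  inj : Function.Injective g
  nonneg : ∀ v, 0 ≤ g v
  lt : ∀ v, g v < (5 * M + 4) * k c - 1
  surj : ∀ z : ℤ, 0 ≤ z → z < (5 * M + 4) * k c - 1 → ∃ v, g v = z
  adj : ∀ {u v}, Adj N M c w u v → -(k c : ℤ) ≤ g u - g v ∧ g u - g v ≤ k c

theorem exists_isLayout (hM : 1 ≤ M) (hN : 1 ≤ N) (hNM : N ≤ c * M)
    (hsum : ∑ i ∈ Finset.Icc 1 N, w i = c * M) (hbw : BandwidthLE (catG N M c w) (k c)) :
    ∃ g : V N M c w → ℤ, IsLayout g := by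
  obtain ⟨g, hg⟩ := hbw
  have hcard := card_V hM hN hNM hsum
  refine ⟨fun v => (g v : ℕ), fun u v h => g.injective (Fin.ext (by exact_mod_cast h)),
    fun v => by positivity, fun v => ?_, fun z h0 h1 => ?_, fun {u v} h => ?_⟩
  · rw [← hcard]; exact_mod_cast (g v).2
  · rw [← hcard] at h1
    refine ⟨g.symm ⟨z.toNat, by omega⟩, ?_⟩
    simp [h0]
  · rw [← abs_le]
    by_cases huv : u = v
    · simp [huv]
    · exact hg u v ((SimpleGraph.fromRel_adj _ _ _).mpr ⟨huv, Or.inl h⟩)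

namespace IsLayout

variable {g : V N M c w → ℤ}

theorem reflect (hg : IsLayout g) : IsLayout (fun v => (5 * M + 4) * k c - 2 - g v) where
  inj u v h := hg.inj (by simpa using h)
  nonneg v := by have := hg.lt v; linarith
  lt v := by have := hg.nonneg v; linarith
  surj z h0 h1 := by
    obtain ⟨v, hv⟩ := hg.surj ((5 * M + 4) * k c - 2 - z) (by linarith) (by linarith)
    exact ⟨v, by rw [hv]; ring⟩
  adj h := by have := hg.adj h; constructor <;> linarith

/-- An interval of positions that is filled by the vertices `ψ x` contains no other vertex. -/
theorem fill (hg : IsLayout g) {α : Type*} [Fintype α] {ψ : α → V N M c w}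
    (hψ : Function.Injective ψ) {l u : ℤ} (hlu : l ≤ u) (h : ∀ x, l ≤ g (ψ x) ∧ g (ψ x) ≤ u)
    (hcard : (u + 1 - l).toNat ≤ Fintype.card α) :
    (0 ≤ l ∧ u < (5 * M + 4) * k c - 1) ∧ ∀ v, l ≤ g v → g v ≤ u → ∃ x, ψ x = v := by
  have key : ∀ z, l ≤ z → z ≤ u → ∃ x, g (ψ x) = z := fun z h1 h2 =>
    exists_eq_of_card_eq (hg.inj.comp hψ) (fun x => Finset.mem_Icc.mpr (h x)) hcard
      (Finset.mem_Icc.mpr ⟨h1, h2⟩)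
  refine ⟨⟨?_, ?_⟩, fun v h1 h2 => ?_⟩
  · obtain ⟨x, hx⟩ := key l le_rfl hlu
    exact hx ▸ hg.nonneg _
  · obtain ⟨x, hx⟩ := key u hlu le_rfl
    exact hx ▸ hg.lt _
  · obtain ⟨x, hx⟩ := key _ h1 h2
    exact ⟨x, hg.inj hx⟩

/-- The closed neighbourhood of `p_0` fills the interval of radius `k` around `p_0`. -/
theorem fill_start (hg : IsLayout g) (hk : 0 < k c) {p q : Fin (5 * M - 2)} (hp : p.1 = 0)
    (hq : q.1 = 1) :
    (0 ≤ g (vp p) - k c ∧ g (vp p) + k c < (5 * M + 4) * k c - 1) ∧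
      ∀ v, g (vp p) - k c ≤ g v → g v ≤ g (vp p) + k c →
        v = vp p ∨ v = vp q ∨ ∃ h, v = vp0hair h := by
  have hψ : Function.Injective (Sum.elim (fun i : Bool => vp (cond i p q)) vp0hair :
      Bool ⊕ Fin (2 * k c - 1) → V N M c w) := by
    refine Function.Injective.sumElim ?_ (fun _ _ h => by cases h; rfl) (fun _ _ => nofun)
    have hpq : p ≠ q := fun h => by rw [h, hq] at hp; omega
    rintro (_ | _) (_ | _) h
    · rfl
    · exact absurd (Sum.inl.inj h) hpq.symm
    · exact absurd (Sum.inl.inj h) hpq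
    · rfl
  have hpq := hg.adj (Adj.spine p q (by omega))
  obtain ⟨h1, h2⟩ := hg.fill hψ (l := g (vp p) - k c) (u := g (vp p) + k c) (by omega) (by
      rintro ((_ | _) | h)
      · simp only [Sum.elim_inl, cond_false]; omega
      · simp only [Sum.elim_inl, cond_true]; omega
      · have := hg.adj (Adj.hair0 h p hp)
        simp only [Sum.elim_inr]; omega)
    (by simp only [Fintype.card_sum, Fintype.card_bool, Fintype.card_fin]; omega)
  refine ⟨h1, fun v hl hu => ?_⟩
  obtain ⟨(_ | _) | h, rfl⟩ := h2 v hl hu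
  · exact Or.inr (Or.inl rfl)
  · exact Or.inl rfl
  · exact Or.inr (Or.inr ⟨h, rfl⟩)

theorem near_center (hg : IsLayout g) :
    (-(k c : ℤ) ≤ g (vtp 0) - g (vtp 1) ∧ g (vtp 0) - g (vtp 1) ≤ k c) ∧
    (-(k c : ℤ) ≤ g (vtp 1) - g (vtp 2) ∧ g (vtp 1) - g (vtp 2) ≤ k c) ∧
    (-(k c : ℤ) ≤ g (vtp 2) - g (vtp 3) ∧ g (vtp 2) - g (vtp 3) ≤ k c) ∧
    (-(k c : ℤ) ≤ g (vtp 3) - g (vtp 4) ∧ g (vtp 3) - g (vtp 4) ≤ k c) ∧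
    (-(k c : ℤ) ≤ g (vtp 4) - g (vtp 5) ∧ g (vtp 4) - g (vtp 5) ≤ k c) :=
  ⟨hg.adj (.tpSpine _ _ rfl), hg.adj (.tpSpine _ _ rfl), hg.adj (.tpSpine _ _ rfl),
    hg.adj (.tpSpine _ _ rfl), hg.adj (.tpSpine _ _ rfl)⟩

theorem near_hair (hg : IsLayout g) (h : Fin (k c)) :
    (-(k c : ℤ) ≤ g (vdhair (h, 0)) - g (vtp 2) ∧ g (vdhair (h, 0)) - g (vtp 2) ≤ k c) ∧
    (-(k c : ℤ) ≤ g (vdhair (h, 0)) - g (vdhair (h, 1)) ∧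
      g (vdhair (h, 0)) - g (vdhair (h, 1)) ≤ k c) ∧
    (-(k c : ℤ) ≤ g (vdhair (h, 1)) - g (vdhair (h, 2)) ∧
      g (vdhair (h, 1)) - g (vdhair (h, 2)) ≤ k c) :=
  ⟨hg.adj (.dhair0 h), hg.adj (.dpath h _ _ rfl), hg.adj (.dpath h _ _ rfl)⟩

/-- The vertices at distance at most three from `v_d` fill the interval of radius `3k` around
`v_d`. -/
theorem fill_turn (hg : IsLayout g) (hk : 2 ≤ k c) {l : Fin (5 * M - 2)} (hl : l.1 = 5 * M - 3) :
    (0 ≤ g (vtp 2) - 3 * k c ∧ g (vtp 2) + 3 * k c < (5 * M + 4) * k c - 1) ∧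
      ∀ v, g (vtp 2) - 3 * k c ≤ g v → g v ≤ g (vtp 2) + 3 * k c →
        v = vp l ∨ (∃ i, v = vtp i) ∨ (∃ h, v = vchair h) ∨ (∃ h, v = vfhair h) ∨
          ∃ h i, v = vdhair (h, i) := by
  have hψ : Function.Injective (Sum.elim (fun _ => vp l) (Sum.elim vtp (Sum.elim vchair
      (Sum.elim vfhair vdhair))) : Unit ⊕ Fin 6 ⊕ Fin (3 * (k c - 2) / 2) ⊕
        Fin (3 * (k c - 2) / 2) ⊕ (Fin (k c) × Fin 3) → V N M c w) := by
    rintro (x | x | x | x | x) (y | y | y | y | y) h <;> cases h <;> rfl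
  obtain ⟨h0, h1, h2, h3, h4⟩ := hg.near_center
  have ha := hg.adj (Adj.tpEnter l hl)
  obtain ⟨h1, h2⟩ := hg.fill hψ (l := g (vtp 2) - 3 * k c) (u := g (vtp 2) + 3 * k c) (by omega)
    (by
      rintro (_ | i | h | h | ⟨h, i⟩) <;> simp only [Sum.elim_inl, Sum.elim_inr]
      · omega
      · fin_cases i <;> simp only [Fin.zero_eta, Fin.mk_one, Fin.reduceFinMk] <;> omega
      · have := hg.adj (Adj.chairE h)
        omega
      · have := hg.adj (Adj.fhairE h)
        omega
      · have := hg.near_hair h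
        fin_cases i <;> simp only [Fin.zero_eta, Fin.mk_one, Fin.reduceFinMk] <;> omega)
    (by
      have := two_dvd_k c
      simp only [Fintype.card_sum, Fintype.card_unit, Fintype.card_fin, Fintype.card_prod]
      omega)
  refine ⟨h1, fun v hlv huv => ?_⟩
  obtain ⟨_ | i | h | h | ⟨h, i⟩, rfl⟩ := h2 v hlv huv
  · exact Or.inl rfl
  · exact Or.inr (Or.inl ⟨i, rfl⟩)
  · exact Or.inr (Or.inr (Or.inl ⟨h, rfl⟩))
  · exact Or.inr (Or.inr (Or.inr (Or.inl ⟨h, rfl⟩)))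
  · exact Or.inr (Or.inr (Or.inr (Or.inr ⟨h, i, rfl⟩)))

/-- The path leaving the turning point at `v_g` returns to the side of `v_d` from which the
spine arrives. -/
theorem left_of_turn (hg : IsLayout g) (hk : 90 ≤ k c) {r l : Fin (5 * M - 2)}
    (hl : l.1 = 5 * M - 3) (hr : l.1 = r.1 + 1) (hrl : g (vp r) < g (vtp 2) - 3 * k c)
    {y : Fin (6 * N - 5)} (hy : y.1 = 0) : g (vy y) < g (vtp 2) - 3 * k c := by
  obtain ⟨⟨hn0, hn1⟩, hfill⟩ := hg.fill_turn (by omega) hl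
  by_contra! hcon
  have hyr : g (vtp 2) + 3 * k c < g (vy y) := by
    by_contra! hle
    rcases hfill _ hcon hle with h | ⟨_, h⟩ | ⟨_, h⟩ | ⟨_, h⟩ | ⟨_, _, h⟩ <;> cases h
  obtain ⟨h0, h1, h2, h3, h4⟩ := hg.near_center
  have hal := hg.adj (Adj.tpEnter l hl)
  have har := hg.adj (Adj.spine r l hr)
  have hgy := hg.adj (Adj.yEnter y hy)
  let A := Finset.univ.filter (fun h : Fin (k c) => g (vdhair (h, 2)) < g (vtp 2) - 2 * k c)
  have hA : k c ≤ A.card + 1 := by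
    have hsub : Finset.Icc (g (vtp 2) - 3 * k c) (g (vtp 2) - 2 * k c - 1) ⊆
        insert (g (vp l)) (A.image fun h => g (vdhair (h, 2))) := by
      intro z hz
      obtain ⟨hz1, hz2⟩ := Finset.mem_Icc.mp hz
      obtain ⟨v, rfl⟩ := hg.surj z (by omega) (by omega)
      rw [Finset.mem_insert, Finset.mem_image]
      rcases hfill v hz1 (by omega) with rfl | ⟨i, rfl⟩ | ⟨h, rfl⟩ | ⟨h, rfl⟩ | ⟨h, i, rfl⟩
      · exact Or.inl rfl
      · exfalso
        fin_cases i <;> simp only [Fin.zero_eta, Fin.mk_one, Fin.reduceFinMk] at hz2 <;> omega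
      · have := hg.adj (Adj.chairE h)
        omega
      · have := hg.adj (Adj.fhairE h)
        omega
      · have := hg.near_hair h
        fin_cases i <;> simp only [Fin.zero_eta, Fin.mk_one, Fin.reduceFinMk] at hz2 ⊢
        · omega
        · omega
        · exact Or.inr ⟨h, Finset.mem_filter.mpr ⟨Finset.mem_univ _, by omega⟩, rfl⟩
    have h5 := (Finset.card_le_card hsub).trans ((Finset.card_insert_le _ _).trans
      (Nat.add_le_add_right Finset.card_image_le 1))
    rw [Int.card_Icc] at h5
    omega
  have hright : ∀ h, g (vtp 2) ≤ g (vchair h) := by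
    intro h
    by_contra! hlt
    have hψ : Function.Injective (Sum.elim (fun _ => vp l) (Sum.elim (fun i => vtp (cond i 0 1))
        (Sum.elim (fun _ => vchair h) (fun x => vdhair (x.1.1, x.2)))) :
        Unit ⊕ Bool ⊕ Unit ⊕ (A × Fin 3) → V N M c w) := by
      rintro (x | (_ | _) | x | ⟨⟨x, hx⟩, i⟩) (y | (_ | _) | y | ⟨⟨y, hy⟩, j⟩) e <;> cases e <;>
        rfl
    have h5 := card_le_of_mem_Icc (hg.inj.comp hψ) Finset.univ (l := g (vtp 2) - 3 * k c)
      (u := g (vtp 2) - 1) (by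
        have := hg.adj (Adj.chairE h)
        rintro (_ | (_ | _) | _ | ⟨⟨x, hx⟩, i⟩) - <;>
          simp only [Function.comp_apply, Sum.elim_inl, Sum.elim_inr, cond_true, cond_false,
            Finset.mem_Icc]
        · omega
        · omega
        · omega
        · omega
        · have := hg.near_hair x
          have := (Finset.mem_filter.mp hx).2
          fin_cases i <;> simp only [Fin.zero_eta, Fin.mk_one, Fin.reduceFinMk] <;> omega)
    simp only [Finset.card_univ, Fintype.card_sum, Fintype.card_unit, Fintype.card_bool,
      Fintype.card_prod, Fintype.card_coe, Fintype.card_fin] at h5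
    omega
  have h5 := card_le_of_mem_Icc (φ := fun h => g (vchair h)) (fun _ _ e => by
      cases hg.inj e; rfl) Finset.univ (l := g (vtp 2)) (u := g (vtp 2) + k c - 1) (fun h _ => by
      have := hg.adj (Adj.chairE h)
      have := hright h
      rw [Finset.mem_Icc]
      omega)
  have := two_dvd_k c
  simp only [Finset.card_univ, Fintype.card_fin] at h5
  omega

/-- If `p_0` precedes `v_d`, then the neighbourhood of `p_0` and the turning point occupy the two
ends of the layout, and the hairs of the `y`-vertices lie strictly between them. -/
theorem ends (hg : IsLayout g) (hk : 90 ≤ k c) (hN : 1 ≤ N) {p q l : Fin (5 * M - 2)}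
    (hp : p.1 = 0) (hq : q.1 = 1) (hl : l.1 = 5 * M - 3) (hlt : g (vp p) < g (vtp 2)) :
    g (vp p) = k c ∧ g (vtp 2) = (5 * M + 1) * k c - 2 ∧
      ∀ x, g (vp p) + k c < g (vyhair x) ∧ g (vyhair x) < g (vtp 2) - 3 * k c := by
  obtain ⟨⟨hs0, hs1⟩, hs⟩ := hg.fill_start (by omega) hp hq
  obtain ⟨⟨ht0, ht1⟩, ht⟩ := hg.fill_turn (by omega) hl
  have hM1 := l.2
  have hpl : g (vp p) < g (vtp 2) - 3 * k c := by
    by_contra! hle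
    rcases ht _ hle (by omega) with h | ⟨_, h⟩ | ⟨_, h⟩ | ⟨_, h⟩ | ⟨_, _, h⟩
    · have := Sum.inl.inj h
      rw [this] at hp
      omega
    all_goals cases h
  have hsep : g (vp p) + k c < g (vtp 2) - 3 * k c := by
    by_contra! hle
    obtain ⟨v, hv⟩ := hg.surj (g (vtp 2) - 3 * k c) ht0 (by omega)
    rcases hs v (by omega) (by omega) with rfl | rfl | ⟨_, rfl⟩ <;>
    rcases ht _ hv.ge (by omega) with h | ⟨_, h⟩ | ⟨_, h⟩ | ⟨_, h⟩ | ⟨_, _, h⟩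
    all_goals first | (cases h; done) | (have := congrArg Fin.val (Sum.inl.inj h); omega)
  obtain ⟨h0, h1, h2, h3, h4⟩ := hg.near_center
  have hal := hg.adj (Adj.tpEnter l hl)
  have hvp_start : ∀ i : Fin (5 * M - 2), 2 ≤ i.1 →
      g (vp i) < g (vp p) - k c ∨ g (vp p) + k c < g (vp i) := by
    intro i hi
    by_contra! hcon
    rcases hs _ hcon.1 hcon.2 with h | h | ⟨_, h⟩
    · have := congrArg Fin.val (Sum.inl.inj h); omega
    · have := congrArg Fin.val (Sum.inl.inj h); omega
    · cases h
  have hvp_turn : ∀ i : Fin (5 * M - 2), i.1 < 5 * M - 3 →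
      g (vp i) < g (vtp 2) - 3 * k c ∨ g (vtp 2) + 3 * k c < g (vp i) := by
    intro i hi
    by_contra! hcon
    rcases ht _ hcon.1 hcon.2 with h | ⟨_, h⟩ | ⟨_, h⟩ | ⟨_, h⟩ | ⟨_, _, h⟩
    · have := congrArg Fin.val (Sum.inl.inj h); omega
    all_goals cases h
  have hspine_left : ∀ i (hi : i < 5 * M - 3),
      g (vp ⟨i, by omega⟩) < g (vtp 2) - 3 * k c := by
    intro i
    induction i with
    | zero =>
      intro hi
      rwa [show (⟨0, by omega⟩ : Fin (5 * M - 2)) = p from Fin.ext hp.symm]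
    | succ i ih =>
      intro hi
      have e1 := ih (by omega)
      have e2 := hg.adj (Adj.spine ⟨i, by omega⟩ ⟨i + 1, by omega⟩ rfl)
      have e3 := hvp_turn ⟨i + 1, by omega⟩ hi
      omega
  have hspine_right : ∀ t (ht : t + 2 ≤ 5 * M - 3),
      g (vp p) + k c < g (vp ⟨5 * M - 3 - t, by omega⟩) := by
    intro t
    induction t with
    | zero =>
      intro _
      rw [show (⟨5 * M - 3 - 0, by omega⟩ : Fin (5 * M - 2)) = l from Fin.ext hl.symm]
      omega
    | succ t ih =>
      intro ht
      have e1 := ih (by omega)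
      have e2 := hg.adj (Adj.spine ⟨5 * M - 3 - (t + 1), by omega⟩ ⟨5 * M - 3 - t, by omega⟩
        (by simp only; omega))
      have e3 := hvp_start ⟨5 * M - 3 - (t + 1), by omega⟩ (by simp only; omega)
      omega
  have hspine : ∀ i : Fin (5 * M - 2), 2 ≤ i.1 → g (vp p) + k c < g (vp i) := by
    intro i hi
    have := hspine_right (5 * M - 3 - i.1) (by omega)
    rwa [show (⟨5 * M - 3 - (5 * M - 3 - i.1), by omega⟩ : Fin (5 * M - 2)) = i from
      Fin.ext (by simp only; omega)] at this
  have hnot_ends : ∀ v, (v ≠ vp p ∧ v ≠ vp q ∧ ∀ h, v ≠ vp0hair h) →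
      (v ≠ vp l ∧ (∀ i, v ≠ vtp i) ∧ (∀ h, v ≠ vchair h) ∧ (∀ h, v ≠ vfhair h) ∧
        ∀ h i, v ≠ vdhair (h, i)) →
      (g v < g (vp p) - k c ∨ g (vp p) + k c < g v) ∧
        (g v < g (vtp 2) - 3 * k c ∨ g (vtp 2) + 3 * k c < g v) := by
    intro v hvs hvt
    constructor
    · by_contra! hcon
      rcases hs _ hcon.1 hcon.2 with h | h | ⟨x, h⟩
      · exact hvs.1 h
      · exact hvs.2.1 h
      · exact hvs.2.2 x h
    · by_contra! hcon
      rcases ht _ hcon.1 hcon.2 with h | ⟨x, h⟩ | ⟨x, h⟩ | ⟨x, h⟩ | ⟨x, i, h⟩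
      · exact hvt.1 h
      · exact hvt.2.1 x h
      · exact hvt.2.2.1 x h
      · exact hvt.2.2.2.1 x h
      · exact hvt.2.2.2.2 x i h
  have hy0 : g (vy ⟨0, by omega⟩) < g (vtp 2) - 3 * k c :=
    hg.left_of_turn hk hl (r := ⟨5 * M - 4, by omega⟩) (by simp only; omega)
      (hspine_left _ (by omega)) rfl
  have hymid : ∀ i (hi : i < 6 * N - 5), g (vp p) + k c < g (vy ⟨i, hi⟩) ∧
      g (vy ⟨i, hi⟩) < g (vtp 2) - 3 * k c := by
    intro i
    induction i with
    | zero =>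
      intro hi
      refine ⟨?_, hy0⟩
      have e1 := hg.adj (Adj.yEnter ⟨0, hi⟩ rfl)
      have e2 := (hnot_ends (vy ⟨0, hi⟩) ⟨nofun, nofun, nofun⟩
        ⟨nofun, nofun, nofun, nofun, nofun⟩)
      omega
    | succ i ih =>
      intro hi
      have e1 := ih (by omega)
      have e2 := hg.adj (Adj.ySpine ⟨i, by omega⟩ ⟨i + 1, hi⟩ rfl)
      have e3 := (hnot_ends (vy ⟨i + 1, hi⟩) ⟨nofun, nofun, nofun⟩
        ⟨nofun, nofun, nofun, nofun, nofun⟩)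
      omega
  have hyhair : ∀ x, g (vp p) + k c < g (vyhair x) ∧ g (vyhair x) < g (vtp 2) - 3 * k c := by
    intro x
    have e1 := hymid (6 * x.1.1) (by have := x.1.2; omega)
    have e2 := hg.adj (Adj.yhairE x ⟨6 * x.1.1, by have := x.1.2; omega⟩ rfl)
    have e3 := (hnot_ends (vyhair x) ⟨nofun, nofun, nofun⟩
      ⟨nofun, nofun, nofun, nofun, nofun⟩)
    omega
  have hfillmid : ∀ i (hi : i < fillLen N M c), g (vp p) + k c < g (vfill ⟨i, hi⟩) ∧
      g (vfill ⟨i, hi⟩) < g (vtp 2) - 3 * k c := by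
    intro i
    induction i with
    | zero =>
      intro hi
      have e1 := hymid (6 * N - 6) (by omega)
      have e2 := hg.adj (Adj.fillEnter ⟨6 * N - 6, by omega⟩ ⟨0, hi⟩ rfl rfl)
      have e3 := (hnot_ends (vfill ⟨0, hi⟩) ⟨nofun, nofun, nofun⟩
        ⟨nofun, nofun, nofun, nofun, nofun⟩)
      omega
    | succ i ih =>
      intro hi
      have e1 := ih (by omega)
      have e2 := hg.adj (Adj.fillPath ⟨i, by omega⟩ ⟨i + 1, hi⟩ rfl)
      have e3 := (hnot_ends (vfill ⟨i + 1, hi⟩) ⟨nofun, nofun, nofun⟩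
        ⟨nofun, nofun, nofun, nofun, nofun⟩)
      omega
  have hpq := hg.adj (Adj.spine p q (by omega))
  have hall : ∀ v, g (vp p) - k c ≤ g v ∧ g v ≤ g (vtp 2) + 3 * k c := by
    rintro (i | h | ⟨i, s, h⟩ | i | h | h | ⟨h, i⟩ | i | x | j)
    · change _ ≤ g (vp i) ∧ g (vp i) ≤ _
      have e1 : g (vp i) ≤ g (vtp 2) + 3 * k c := by
        by_cases hi : i.1 < 5 * M - 3
        · have := hspine_left i.1 hi
          change g (vp i) < _ at this
          omega
        · rw [show i = l from Fin.ext (by have := i.2; omega)]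
          omega
      refine ⟨?_, e1⟩
      by_cases hi : 2 ≤ i.1
      · have := hspine i hi
        omega
      · rcases (by omega : i.1 = 0 ∨ i.1 = 1) with h | h
        · rw [show i = p from Fin.ext (by omega)]
          omega
        · rw [show i = q from Fin.ext (by omega)]
          omega
    · change _ ≤ g (vp0hair h) ∧ g (vp0hair h) ≤ _
      have := hg.adj (Adj.hair0 h p hp)
      omega
    · change _ ≤ g (vphair (i, s, h)) ∧ g (vphair (i, s, h)) ≤ _
      have hi := i.2
      have hm : 3 ≤ 5 * (i.1 + 1) - cond s 2 0 ∧ 5 * (i.1 + 1) - cond s 2 0 < 5 * M - 3 := by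
        cases s <;> simp only [cond_true, cond_false] <;> omega
      have e0 := hspine_left _ hm.2
      have e1 := hspine ⟨5 * (i.1 + 1) - cond s 2 0, by omega⟩ (by simp only; omega)
      have e2 := hg.adj (Adj.phairE i s h ⟨5 * (i.1 + 1) - cond s 2 0, by omega⟩ rfl)
      have e3 := (hnot_ends (vphair (i, s, h)) ⟨nofun, nofun, nofun⟩
        ⟨nofun, nofun, nofun, nofun, nofun⟩)
      omega
    · change _ ≤ g (vtp i) ∧ g (vtp i) ≤ _
      fin_cases i <;> simp only [Fin.zero_eta, Fin.mk_one, Fin.reduceFinMk] <;> omega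
    · change _ ≤ g (vchair h) ∧ g (vchair h) ≤ _
      have := hg.adj (Adj.chairE h)
      omega
    · change _ ≤ g (vfhair h) ∧ g (vfhair h) ≤ _
      have := hg.adj (Adj.fhairE h)
      omega
    · change _ ≤ g (vdhair (h, i)) ∧ g (vdhair (h, i)) ≤ _
      have := hg.near_hair h
      fin_cases i <;> simp only [Fin.zero_eta, Fin.mk_one, Fin.reduceFinMk] <;> omega
    · have := hymid i.1 i.2
      change _ ≤ g (vy i) ∧ g (vy i) ≤ _
      change _ < g (vy i) ∧ g (vy i) < _ at this
      omega
    · have := hyhair x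
      change _ ≤ g (vyhair x) ∧ g (vyhair x) ≤ _
      omega
    · have := hfillmid j.1 j.2
      change _ ≤ g (vfill j) ∧ g (vfill j) ≤ _
      change _ < g (vfill j) ∧ g (vfill j) < _ at this
      omega
  obtain ⟨v0, hv0⟩ := hg.surj 0 le_rfl (by omega)
  obtain ⟨v1, hv1⟩ := hg.surj ((5 * M + 4) * k c - 2) (by omega) (by omega)
  have e0 := (hall v0).1
  have e1 := (hall v1).2
  have e2 : ((5 * M + 4) * k c : ℤ) = (5 * M + 1) * k c + 3 * k c := by ring
  exact ⟨by omega, by omega, hyhair⟩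

/-- At most `2b` hairs of `y`-vertices lie within distance `k` of a spine vertex carrying
`2k - 2b` hairs. -/
theorem card_yhair_near_le (hg : IsLayout g) (i : Fin (M - 1)) (s : Bool) {m : Fin (5 * M - 2)}
    (hm : m.1 = 5 * (i.1 + 1) - cond s 2 0) :
    (Finset.univ.filter (fun x => |g (vyhair x) - g (vp m)| ≤ k c)).card ≤ 2 * b c := by
  set S := Finset.univ.filter (fun x => |g (vyhair x) - g (vp m)| ≤ k c)
  have hψ : Function.Injective (Sum.elim (fun x => vyhair x.1) (Sum.elim
      (fun h => vphair (i, s, h)) (fun _ => vp m)) :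
      S ⊕ Fin (2 * k c - 2 * b c) ⊕ Unit → V N M c w) := by
    rintro (⟨x, hx⟩ | x | x) (⟨y, hy⟩ | y | y) e <;> cases e <;> rfl
  have h := card_le_of_mem_Icc (hg.inj.comp hψ) Finset.univ (l := g (vp m) - k c)
    (u := g (vp m) + k c) (by
      rintro (⟨x, hx⟩ | h | _) - <;>
        simp only [Function.comp_apply, Sum.elim_inl, Sum.elim_inr, Finset.mem_Icc]
      · have := abs_le.mp (Finset.mem_filter.mp hx).2
        omega
      · have := hg.adj (Adj.phairE i s h m hm)
        omega
      · omega)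
  simp only [Finset.card_univ, Fintype.card_sum, Fintype.card_unit, Fintype.card_coe,
    Fintype.card_fin] at h
  omega

/-- The positions of the path `p_0, …, p_{5M-3}, v_b, v_c, v_d`. -/
def spinePos (g : V N M c w → ℤ) (m : ℕ) : ℤ :=
  if h : m < 5 * M - 2 then g (vp ⟨m, h⟩) else g (vtp ⟨min (m - (5 * M - 2)) 2, by omega⟩)

theorem spinePos_of_lt (g : V N M c w → ℤ) {m : ℕ} (h : m < 5 * M - 2) :
    spinePos g m = g (vp ⟨m, h⟩) := dif_pos h

theorem spinePos_add (g : V N M c w → ℤ) {m : ℕ} (i : Fin 6) (hi : i.1 ≤ 2)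
    (h : m = 5 * M - 2 + i.1) : spinePos g m = g (vtp i) := by
  subst h
  unfold spinePos
  rw [dif_neg (by omega)]
  congr 2
  exact Fin.ext (by simp only; omega)

theorem spinePos_succ_le (hg : IsLayout g) (hM : 1 ≤ M) :
    ∀ m < 5 * M, spinePos g (m + 1) ≤ spinePos g m + k c := by
  intro m hm
  obtain ⟨h0, h1, -⟩ := hg.near_center
  by_cases h : m + 1 < 5 * M - 2
  · rw [spinePos_of_lt g h, spinePos_of_lt g (by omega : m < 5 * M - 2)]
    have := hg.adj (Adj.spine ⟨m, by omega⟩ ⟨m + 1, h⟩ rfl)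
    omega
  · rcases (by omega : m = 5 * M - 3 ∨ m = 5 * M - 2 ∨ m = 5 * M - 1) with h | h | h
    · rw [spinePos_of_lt g (by omega : m < 5 * M - 2),
        spinePos_add g 0 (m := m + 1) (by simp) (show _ = 5 * M - 2 + 0 by omega)]
      have := hg.adj (Adj.tpEnter ⟨m, by omega⟩ h)
      omega
    · rw [spinePos_add g 0 (m := m) (by simp) (show _ = 5 * M - 2 + 0 by omega),
        spinePos_add g 1 (m := m + 1) (by simp) (show _ = 5 * M - 2 + 1 by omega)]
      omega
    · rw [spinePos_add g 1 (m := m) (by simp) (show _ = 5 * M - 2 + 1 by omega),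
        spinePos_add g 2 (m := m + 1) (by simp) (show _ = 5 * M - 2 + 2 by omega)]
      omega

theorem exists_emulation_of_lt (hg : IsLayout g) (hM : 1 ≤ M) (hN : 1 ≤ N) (hc : 6 < c)
    (hw : ∀ i ∈ Finset.Icc 1 N, 0 < w i) (hsum : ∑ i ∈ Finset.Icc 1 N, w i = c * M)
    (hlt : g (vp ⟨0, by omega⟩) < g (vtp 2)) :
    ∃ f : ℕ → ℕ, IsUniformEmulation N M c w f ∧ f 1 = M := by
  have hk := le_k hc
  obtain ⟨hp, hd, hx⟩ := hg.ends hk hN (q := ⟨1, by omega⟩) (l := ⟨5 * M - 3, by omega⟩)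
    rfl rfl rfl hlt
  have ha0 : spinePos g 0 = k c := by rw [spinePos_of_lt g (by omega), hp]
  have haM : spinePos g (5 * M) = g (vtp 2) :=
    spinePos_add g 2 (by simp) (show _ = 5 * M - 2 + 2 by omega)
  have hab : spinePos g (5 * M - 2) = g (vtp 0) :=
    spinePos_add g 0 (by simp) (show _ = 5 * M - 2 + 0 by omega)
  have hhi : ∀ x, g (vyhair x) < spinePos g (5 * M - 2) - k c := by
    intro x
    have := hx x
    have := hg.near_center
    omega
  have hlo : ∀ x, spinePos g 0 + k c < g (vyhair x) := fun x => by
    have := (hx x).1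
    omega
  let Y : ℕ → ℤ := fun i => if h : 6 * i < 6 * N - 5 then g (vy ⟨6 * i, h⟩) else 0
  have hYeq : ∀ {i : ℕ} (h : i < N), Y i = g (vy ⟨6 * i, by omega⟩) := fun h => dif_pos (by omega)
  refine exists_emulation (a := spinePos g) (Y := Y) (B := b c) (K := k c)
    (φ := fun x => g (vyhair x)) hM hN (by unfold b; omega) (by simp [k]) (by omega) hw hsum
    (fun x y e => by cases hg.inj e; rfl) ?_ ?_ ?_ ha0 (by rw [haM, hd]) (hg.spinePos_succ_le hM)
    hlo hhi ?_ ?_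
  · intro x
    rw [hYeq x.1.2, abs_le]
    exact hg.adj (Adj.yhairE x _ rfl)
  · intro i hi
    rw [hYeq hi, hYeq (by omega : i < N), abs_le]
    have step : ∀ t (ht : 6 * i + t + 1 < 6 * N - 5),
        -(k c : ℤ) ≤ g (vy ⟨6 * i + t, by omega⟩) - g (vy ⟨6 * i + t + 1, ht⟩) ∧
        g (vy ⟨6 * i + t, by omega⟩) - g (vy ⟨6 * i + t + 1, ht⟩) ≤ k c := fun t ht =>
      hg.adj (Adj.ySpine _ _ rfl)
    have s0 := step 0 (by omega)
    have s1 := step 1 (by omega)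
    have s2 := step 2 (by omega)
    have s3 := step 3 (by omega)
    have s4 := step 4 (by omega)
    have s5 := step 5 (by omega)
    simp only [Nat.add_assoc, Nat.add_zero, Nat.reduceAdd, Nat.mul_add,
      Nat.mul_one] at s0 s1 s2 s3 s4 s5 ⊢
    omega
  · rw [hYeq hN]
    have e1 := hg.adj (Adj.yEnter ⟨6 * 0, by omega⟩ rfl)
    have e2 := hg.near_center
    have e3 : ((5 * M - 3) * k c - 2 : ℤ) = (5 * M + 1) * k c - 2 - 4 * k c := by ring
    rw [e3, ← hd]
    omega
  · intro j hj
    rcases Nat.eq_zero_or_pos j with rfl | hj0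
    · rw [Finset.card_eq_zero.mpr (Finset.filter_eq_empty_iff.mpr fun x _ => ?_)]
      · exact Nat.zero_le _
      · have := hlo x
        rw [abs_le]
        simp only [Nat.mul_zero]
        omega
    · rw [spinePos_of_lt g (by omega)]
      exact hg.card_yhair_near_le ⟨j - 1, by omega⟩ false (by simp only [cond_false]; omega)
  · intro j hj
    by_cases hjM : j + 1 = M
    · rw [Finset.card_eq_zero.mpr (Finset.filter_eq_empty_iff.mpr fun x _ => ?_)]
      · exact Nat.zero_le _
      · have := hhi x
        rw [abs_le, show 5 * j + 3 = 5 * M - 2 by omega]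
        omega
    · rw [spinePos_of_lt g (by omega)]
      exact hg.card_yhair_near_le ⟨j, by omega⟩ true (by simp only [cond_true]; omega)

end IsLayout
end Caterpillar

open Caterpillar in
/-- if the caterpillar `G` has bandwidth at most `k = 9bc + b` (where
`b = 12c + 6`), then `P_N` with weights `w` has a uniform emulation `f` on `P_M` with
emulation factor `c` such that `f(1) = M`. -/
theorem stmt_3 (N M c : ℕ) (hN : 1 ≤ N) (hM : 1 ≤ M) (hc : 6 < c)
    (w : ℕ → ℕ) (hw : ∀ i ∈ Finset.Icc 1 N, 0 < w i)
    (hsum : ∑ i ∈ Finset.Icc 1 N, w i = c * M)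
    (hbw : BandwidthLE (catG N M c w) (k c)) :
    ∃ f : ℕ → ℕ, IsUniformEmulation N M c w f ∧ f 1 = M := by
  have hNM : N ≤ c * M := by
    rw [← hsum]
    calc N = ∑ i ∈ Finset.Icc 1 N, 1 := by simp
      _ ≤ _ := Finset.sum_le_sum hw
  obtain ⟨g, hg⟩ := exists_isLayout hM hN hNM hsum hbw
  have hne : g (vp ⟨0, by omega⟩) ≠ g (vtp 2) := fun e => by cases hg.inj e
  rcases hne.lt_or_gt with h | h
  · exact hg.exists_emulation_of_lt hM hN hc hw hsum h
  · exact hg.reflect.exists_emulation_of_lt hM hN hc hw hsum (by linarith)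
end

section
/- Let N ≥ M ≥ 1 be integers, w: {1,…,N} → ℤ⁺ a weight function, and f a uniform emulation of P_N with weights w on P_M with emulation factor c. Suppose that 2·w(i) > c for every i with 1 ≤ i ≤ M. Then either f(i) = i for all i ∈ {1,…,M}, or f(i) = M+1−i for all i ∈ {1,…,M}. -/
/-- In a uniform emulation, two distinct vertices of weight more than `c / 2` have distinct
images. -/
theorem IsUniformEmulation.eq_of_apply_eq {N M c : ℕ} {w f : ℕ → ℕ}
    (hf : IsUniformEmulation N M c w f) {a b : ℕ} (ha : a ∈ Finset.Icc 1 N)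
    (hb : b ∈ Finset.Icc 1 N) (hwa : c < 2 * w a) (hwb : c < 2 * w b) (hab : f a = f b) :
    a = b := by
  by_contra hne
  have hsub : ({a, b} : Finset ℕ) ⊆ (Finset.Icc 1 N).filter (fun i => f i = f a) := by
    intro x hx
    rcases Finset.mem_insert.mp hx with rfl | hx
    · simp [ha]
    · rw [Finset.mem_singleton.mp hx]
      simp [hb, hab]
  have hle := Finset.sum_le_sum_of_subset (f := w) hsub
  rw [Finset.sum_pair hne, hf.2.2 (f a) (hf.1 a ha)] at hle
  omega

/-- An injective walk on the integers with steps of size at most one is monotone with unit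
steps. -/
theorem unit_steps_of_injOn {M : ℕ} {f : ℕ → ℕ}
    (hstep : ∀ i, 1 ≤ i → i < M → |(f (i + 1) : ℤ) - (f i : ℤ)| ≤ 1)
    (hinj : Set.InjOn f (Set.Icc 1 M)) {k : ℕ} (hk : 1 ≤ k) (hkM : k ≤ M) :
    (∀ i, 1 ≤ i → i ≤ k → f i + 1 = f 1 + i) ∨ (∀ i, 1 ≤ i → i ≤ k → f i + i = f 1 + 1) := by
  induction k, hk using Nat.le_induction with
  | base =>
    left
    intro i h1 h2
    obtain rfl : i = 1 := by omega
    rfl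
  | succ k hk ih =>
    have hs := abs_le.mp (hstep k hk (by omega))
    have hne : f (k + 1) ≠ f k := fun h => by
      have := hinj ⟨by omega, hkM⟩ ⟨hk, by omega⟩ h
      omega
    have hne' : 2 ≤ k → f (k + 1) ≠ f (k - 1) := fun h2 h => by
      have := hinj ⟨by omega, hkM⟩ ⟨by omega, by omega⟩ h
      omega
    by_cases hk1 : k = 1
    · subst hk1
      rw [one_add_one_eq_two] at hs hne
      rcases (by omega : f 2 = f 1 + 1 ∨ f 2 + 1 = f 1) with h | h
      · left
        intro i h1 h2
        rcases (by omega : i = 1 ∨ i = 2) with rfl | rfl <;> omega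
      · right
        intro i h1 h2
        rcases (by omega : i = 1 ∨ i = 2) with rfl | rfl <;> omega
    · have hne'' := hne' (by omega)
      refine (ih (by omega)).imp (fun h i h1 h2 => ?_) (fun h i h1 h2 => ?_) <;>
      · have hk' := h k hk le_rfl
        have hp := h (k - 1) (by omega) (by omega)
        rcases (by omega : i ≤ k ∨ i = k + 1) with hi | rfl
        · exact h i h1 hi
        · omega

/-- if each of the first `M` vertices of `P_N` has weight more than `c/2`,
then a uniform emulation with factor `c` maps the first `M` vertices either identically
or reversed onto `P_M`. -/
theorem stmt_6 (N M c : ℕ) (hM : 1 ≤ M) (hMN : M ≤ N) (w : ℕ → ℕ)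
    (hw : ∀ i ∈ Finset.Icc 1 N, 0 < w i) (f : ℕ → ℕ)
    (hf : IsUniformEmulation N M c w f)
    (hbig : ∀ i ∈ Finset.Icc 1 M, c < 2 * w i) :
    (∀ i ∈ Finset.Icc 1 M, f i = i) ∨ (∀ i ∈ Finset.Icc 1 M, f i = M + 1 - i) := by
  have hinj : Set.InjOn f (Set.Icc 1 M) := fun a ha b hb hab =>
    hf.eq_of_apply_eq (Finset.mem_Icc.mpr ⟨ha.1, ha.2.trans hMN⟩)
      (Finset.mem_Icc.mpr ⟨hb.1, hb.2.trans hMN⟩) (hbig a (Finset.mem_Icc.mpr ha))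
      (hbig b (Finset.mem_Icc.mpr hb)) hab
  have h1 := Finset.mem_Icc.mp (hf.1 1 (Finset.mem_Icc.mpr ⟨le_rfl, hM.trans hMN⟩))
  have h2 := Finset.mem_Icc.mp (hf.1 M (Finset.mem_Icc.mpr ⟨hM, hMN⟩))
  refine (unit_steps_of_injOn (fun i hi hiM => hf.2.1 i hi (by omega)) hinj hM le_rfl).imp
    (fun h i hi => ?_) (fun h i hi => ?_) <;>
  · have hi' := Finset.mem_Icc.mp hi
    have hfi := h i hi'.1 hi'.2
    have hfM := h M hM le_rfl
    omega
end

section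
/- Let M ≥ 1 and let f: {1,…,M} → {1,…,M} be an injective map with |f(i+1) − f(i)| ≤ 1 for all 1 ≤ i < M. Then either f(i) = i for all i, or f(i) = M+1−i for all i. -/
/-- an injective map of `{1,…,M}` into itself whose consecutive values
differ by at most one is either the identity or the reversal `i ↦ M+1-i`. -/
theorem stmt_7 (M : ℕ) (hM : 1 ≤ M) (f : ℕ → ℕ)
    (hmaps : ∀ i ∈ Finset.Icc 1 M, f i ∈ Finset.Icc 1 M)
    (hinj : Set.InjOn f (Finset.Icc 1 M))
    (hstep : ∀ i, 1 ≤ i → i < M → |(f (i+1) : ℤ) - (f i : ℤ)| ≤ 1) :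
    (∀ i ∈ Finset.Icc 1 M, f i = i) ∨ (∀ i ∈ Finset.Icc 1 M, f i = M + 1 - i) := by
  have hb : ∀ i, 1 ≤ i → i ≤ M → 1 ≤ f i ∧ f i ≤ M := fun i h1 h2 =>
    Finset.mem_Icc.mp (hmaps i (Finset.mem_Icc.mpr ⟨h1, h2⟩))
  have hne : ∀ i j, 1 ≤ i → i < j → j ≤ M → f i ≠ f j := by
    intro i j hi hij hj h
    have := hinj (Finset.mem_coe.mpr (Finset.mem_Icc.mpr ⟨hi, by omega⟩))
      (Finset.mem_coe.mpr (Finset.mem_Icc.mpr ⟨by omega, hj⟩)) h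
    omega
  have hunit : ∀ i, 1 ≤ i → i < M → f (i + 1) = f i + 1 ∨ f i = f (i + 1) + 1 := by
    intro i hi hiM
    have h := abs_le.mp (hstep i hi hiM)
    have := hne i (i + 1) hi (by omega) hiM
    omega
  have hmono : (∀ i, 1 ≤ i → i < M → f (i + 1) = f i + 1) ∨
      (∀ i, 1 ≤ i → i < M → f i = f (i + 1) + 1) := by
    by_cases hM1 : 1 < M
    · refine (hunit 1 le_rfl hM1).imp ?_ ?_ <;>
      · intro h i hi
        induction i, hi using Nat.le_induction with
        | base => exact fun _ => h
        | succ k hk ih =>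
          intro hkM
          have := ih (by omega)
          have := hunit (k + 1) (by omega) hkM
          have := hne k (k + 1 + 1) hk (by omega) hkM
          omega
    · left; intro i h1 h2; omega
  have h1 := hb 1 le_rfl hM
  have hlast := hb M hM le_rfl
  rcases hmono with h | h
  · have key : ∀ i, 1 ≤ i → i ≤ M → f i + 1 = f 1 + i := by
      intro i hi
      induction i, hi using Nat.le_induction with
      | base => exact fun _ => rfl
      | succ k hk ih =>
        intro hkM
        have := ih (by omega)
        have := h k hk hkM
        omega
    left
    intro i hi
    obtain ⟨hi1, hiM⟩ := Finset.mem_Icc.mp hi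
    have := key i hi1 hiM
    have := key M hM le_rfl
    omega
  · have key : ∀ i, 1 ≤ i → i ≤ M → f i + i = f 1 + 1 := by
      intro i hi
      induction i, hi using Nat.le_induction with
      | base => exact fun _ => rfl
      | succ k hk ih =>
        intro hkM
        have := ih (by omega)
        have := h k hk hkM
        omega
    right
    intro i hi
    obtain ⟨hi1, hiM⟩ := Finset.mem_Icc.mp hi
    have := key i hi1 hiM
    have := key M hM le_rfl
    omega
end

section
/- Let m ≥ 1 and q ≥ 1 be integers and a ∈ ℤ, and for each j ∈ {1,…,q} let I_j = {a+(2j−1)m, a+(2j−1)m+1, …, a+2jm−1}. Then every set W of 3m consecutive integers with W ⊆ {a, a+1, …, a+(2q+1)m−1} contains some I_j as a subset. -/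
/-- among the `q` blocks `I_j = {a+(2j-1)m, …, a+2jm-1}` inside
`{a, …, a+(2q+1)m-1}`, every set of `3m` consecutive integers contained in
`{a, …, a+(2q+1)m-1}` fully contains some block `I_j`. -/
theorem stmt_8 (m q : ℕ) (hm : 1 ≤ m) (hq : 1 ≤ q) (a : ℤ) (s : ℤ)
    (hW : Set.Icc s (s + 3*(m:ℤ) - 1) ⊆ Set.Icc a (a + (2*(q:ℤ)+1)*m - 1)) :
    ∃ j : ℕ, 1 ≤ j ∧ j ≤ q ∧
      Set.Icc (a + (2*(j:ℤ)-1)*m) (a + 2*(j:ℤ)*m - 1) ⊆ Set.Icc s (s + 3*(m:ℤ) - 1) := by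
  obtain ⟨has, -⟩ := hW (Set.left_mem_Icc.2 (by omega))
  obtain ⟨-, hsb⟩ := hW (Set.right_mem_Icc.2 (by omega))
  have hm' : (1 : ℤ) ≤ m := by exact_mod_cast hm
  -- the first block starting at or after `s` is `I_{d+1}`
  obtain ⟨d, hd⟩ : ∃ d : ℕ, (d : ℤ) = (s - a + m - 1) / (2 * m) :=
    ⟨_, Int.toNat_of_nonneg (Int.ediv_nonneg (by linarith) (by linarith))⟩
  have hle : 2 * m * (d : ℤ) ≤ s - a + m - 1 := by
    rw [hd]
    exact Int.mul_ediv_self_le (by omega)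
  have hlt : s - a + m - 1 < 2 * m * (d : ℤ) + 2 * m := by
    rw [hd]
    exact Int.lt_mul_ediv_self_add (by omega)
  refine ⟨d + 1, by omega, ?_, ?_⟩
  · have hdq : (d : ℤ) < q := by
      by_contra! h
      nlinarith [mul_le_mul_of_nonneg_left h (by omega : (0 : ℤ) ≤ m)]
    omega
  · push_cast
    apply Set.Icc_subset_Icc <;> linarith
end

section
/- Let i ≤ j be integers and let γ ≥ 0 be an integer with γ ≥ j − i − 1. Then there exists a map g: {0,1,…,γ+1} → ℤ such that g(0) = i, g(γ+1) = j, |g(δ+1) − g(δ)| ≤ 1 for all 0 ≤ δ ≤ γ, every value g(δ) lies in the interval [i, j + ⌈(γ+1−(j−i))/2⌉], and every integer has at most two preimages under g. -/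
/-- "folding a path": for integers `i ≤ j` and `γ ≥ j - i - 1`, a path with
`γ` internal vertices from a vertex at `i` to a vertex at `j` can be laid out on the
integers so that consecutive vertices are at equal or adjacent integers, all values stay
in `[i, j + ⌈(γ+1-(j-i))/2⌉]`, and every integer receives at most two vertices. -/
theorem stmt_12 (i j : ℤ) (hij : i ≤ j) (γ : ℕ) (hγ : j - i - 1 ≤ (γ:ℤ)) :
    ∃ g : ℕ → ℤ, g 0 = i ∧ g (γ+1) = j ∧
      (∀ δ : ℕ, δ ≤ γ → |g (δ+1) - g δ| ≤ 1) ∧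
      (∀ δ : ℕ, δ ≤ γ+1 → g δ ∈ Set.Icc i (j + ((γ:ℤ) + 1 - (j - i) + 1)/2)) ∧
      (∀ z : ℤ, ((Finset.range (γ+2)).filter (fun δ => g δ = z)).card ≤ 2) := by
  refine ⟨fun δ => min (i + δ) (j + (γ + 1) - δ), ?_, ?_, ?_, ?_, ?_⟩
  · simp only; omega
  · push_cast; omega
  · intro δ _
    rw [abs_le]
    push_cast
    omega
  · intro δ hδ
    simp only [Set.mem_Icc]
    omega
  · intro z
    refine (Finset.card_le_card (t := {(z - i).toNat, (j + (γ + 1) - z).toNat}) ?_).trans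
      Finset.card_le_two
    intro δ hδ
    simp only [Finset.mem_filter, Finset.mem_range] at hδ
    simp only [Finset.mem_insert, Finset.mem_singleton]
    omega
end
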